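/- arXiv:1909.08448 — 3 statements merged into one kernel-verified Lean document; each statement's English description precedes it below -/
import Mathlib

section
/- Let d ≥ 1 and let y = (y_I), indexed by the nonempty subsets I ⊆ [d], be a vector of integers such that for every 2-element E ⊆ [d] and every T with E ⊆ T ⊆ [d], Σ_{I : E ⊆ I ⊆ T} y_I ≥ 0. Let P be the generalized permutahedron with P + Σ_{I : y_I<0}(−y_I)·Δ_I = Σ_{I : y_I≥0} y_I·Δ_I. Then |P ∩ ℤ^d| = Σ_a C(y_{[d]} + a_{[d]}, a_{[d]}) · Π_{∅≠I⊊[d]} C(y_I + a_I − 1, a_I), where the sum ranges over all vectors (a_I) of nonnegative integers indexed by nonempty subsets I ⊆ [d] such that Σ_I a_I = d − 1 and for every nonempty collection M of nonempty subsets of [d] one has |⋃_{J∈M} J| ≥ 1 + Σ_{J∈M} a_J. Here for an integer x and a nonnegative integer a, C(x, a) denotes the generalized binomial coefficient x(x−1)⋯(x−a+1)/a!. -/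
open Finset Pointwise

open scoped Classical

/-- The standard simplex `Δ_I ⊆ ℝ^d`: the convex hull of `{e_i : i ∈ I}`. -/
def stdSimp (d : ℕ) (I : Finset (Fin d)) : Set (Fin d → ℝ) :=
  convexHull ℝ ((fun i => (Pi.single i 1 : Fin d → ℝ)) '' (I : Set (Fin d)))

/-- The permutahedron `Π_d`: the convex hull of the points `(σ(1),…,σ(d))`. -/
def permutahedron (d : ℕ) : Set (Fin d → ℝ) :=
  convexHull ℝ {x | ∃ σ : Equiv.Perm (Fin d), x = fun i => ((σ i : ℕ) + 1 : ℝ)}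

/-- A polytope is the convex hull of a finite set of points. -/
def IsPolytope {d : ℕ} (P : Set (Fin d → ℝ)) : Prop :=
  ∃ S : Finset (Fin d → ℝ), P = convexHull ℝ (S : Set (Fin d → ℝ))

/-- A generalized permutahedron: a polytope `P` such that `P + Q = λ • Π_d`
for some polytope `Q` and some `λ > 0`. -/
def IsGenPerm {d : ℕ} (P : Set (Fin d → ℝ)) : Prop :=
  IsPolytope P ∧ ∃ lam : ℝ, 0 < lam ∧ ∃ Q : Set (Fin d → ℝ), IsPolytope Q ∧
    P + Q = lam • permutahedron d

/-- The lattice `ℤ^d` inside `ℝ^d`. -/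
def latticePts (d : ℕ) : Set (Fin d → ℝ) := {x | ∀ i, ∃ m : ℤ, x i = (m : ℝ)}

/-- The generalized binomial coefficient `C(x, a) = x(x−1)⋯(x−a+1)/a!` for `x : ℤ`. -/
noncomputable def genC (x : ℤ) (a : ℕ) : ℝ :=
  (∏ t ∈ Finset.range a, ((x : ℝ) - (t : ℝ))) / (a.factorial : ℝ)

section MultichooseSums

/-- The multiset coefficient `C(x + a - 1, a)`. -/
noncomputable def multiC (x : ℤ) (a : ℕ) : ℝ := genC (x + a - 1) a

@[simp] lemma multiC_zero (x : ℤ) : multiC x 0 = 1 := by simp [multiC, genC]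

@[simp] lemma multiC_zero_succ (a : ℕ) : multiC 0 (a + 1) = 0 := by
  simp only [multiC, genC, div_eq_zero_iff]
  left
  refine Finset.prod_eq_zero (Finset.self_mem_range_succ a) ?_
  push_cast
  ring

lemma multiC_succ_sub (x : ℤ) (a : ℕ) :
    multiC x (a + 1) - multiC (x - 1) (a + 1) = multiC x a := by
  simp only [multiC, genC]
  rw [Finset.prod_range_succ', Finset.prod_range_succ]
  have h : ∀ t ∈ Finset.range a, ((x + ((a + 1 : ℕ) : ℤ) - 1 : ℤ) : ℝ) - ((t + 1 : ℕ) : ℝ)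
      = ((x + a - 1 : ℤ) : ℝ) - t := fun t _ => by push_cast; ring
  have h' : ∀ t ∈ Finset.range a, ((x - 1 + ((a + 1 : ℕ) : ℤ) - 1 : ℤ) : ℝ) - (t : ℝ)
      = ((x + a - 1 : ℤ) : ℝ) - t := fun t _ => by push_cast; ring
  rw [Finset.prod_congr rfl h, Finset.prod_congr rfl h', Nat.factorial_succ]
  have := Nat.factorial_ne_zero a
  push_cast
  field_simp
  ring

variable {ι : Type*} [Fintype ι] [DecidableEq ι]

/-- Induction on integer vectors: raise negative entries first, then lower positive ones. -/
lemma int_vector_induction {p : (ι → ℤ) → Prop} (zero : p 0)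
    (neg : ∀ y j, y j < 0 → p (y + Pi.single j 1) → p y)
    (pos : ∀ y j, (∀ k, 0 ≤ y k) → 0 < y j → p (y - Pi.single j 1) → p y) (y : ι → ℤ) : p y := by
  induction h : ∑ j, (y j).natAbs using Nat.strong_induction_on generalizing y with
  | _ m ih =>
  subst h
  by_cases hneg : ∃ j, y j < 0
  · obtain ⟨j, hj⟩ := hneg
    refine neg y j hj (ih _ ?_ _ rfl)
    refine Finset.sum_lt_sum (fun k _ => ?_) ⟨j, Finset.mem_univ j, ?_⟩
    · by_cases hk : k = j
      · subst hk; simp; omega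
      · simp [hk]
    · simp; omega
  push Not at hneg
  by_cases hpos : ∃ j, 0 < y j
  · obtain ⟨j, hj⟩ := hpos
    refine pos y j hneg hj (ih _ ?_ _ rfl)
    refine Finset.sum_lt_sum (fun k _ => ?_) ⟨j, Finset.mem_univ j, ?_⟩
    · by_cases hk : k = j
      · subst hk; simp; omega
      · simp [hk]
    · simp; omega
  push Not at hpos
  rwa [show y = 0 from funext fun k => le_antisymm (hpos k) (hneg k)]

lemma eq_zero_of_shift_invariant {f : (ι → ℤ) → ℝ} (h0 : f 0 = 0)
    (hf : ∀ y j, f (y - Pi.single j 1) = f y) (y : ι → ℤ) : f y = 0 := by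
  induction y using int_vector_induction with
  | zero => exact h0
  | neg y j _ ih => rw [← ih, ← hf (y + Pi.single j 1) j, add_sub_cancel_right]
  | pos y j _ _ ih => rw [← hf y j, ih]

/-- The sum `∑ φ(b) ∏ⱼ C(yⱼ + bⱼ - 1, bⱼ)` over vectors `b` supported on `s` with entries below
`n`. -/
noncomputable def multiCSum (n : ℕ) (s : Finset ι) (φ : (ι → ℕ) → ℝ) (y : ι → ℤ) : ℝ :=
  ∑ b ∈ (Fintype.piFinset fun _ => Finset.range n).filter (fun b : ι → ℕ => ∀ j ∉ s, b j = 0),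
    φ b * ∏ j, multiC (y j) (b j)

lemma multiCSum_congr {n : ℕ} {s : Finset ι} {φ ψ : (ι → ℕ) → ℝ}
    (h : ∀ b, φ b = ψ b) (y : ι → ℤ) : multiCSum n s φ y = multiCSum n s ψ y := by
  rw [show φ = ψ from funext h]

lemma multiCSum_sub (n : ℕ) (s : Finset ι) (φ ψ : (ι → ℕ) → ℝ) (y : ι → ℤ) :
    multiCSum n s (fun b => φ b - ψ b) y = multiCSum n s φ y - multiCSum n s ψ y := by
  simp [multiCSum, sub_mul, Finset.sum_sub_distrib]

lemma multiCSum_zero_right {n : ℕ} (hn : 0 < n) (s : Finset ι) (φ : (ι → ℕ) → ℝ) :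
    multiCSum n s φ 0 = φ 0 := by
  rw [multiCSum, Finset.sum_eq_single 0]
  · simp
  · intro b _ hb
    obtain ⟨j, hj⟩ := Function.ne_iff.1 hb
    obtain ⟨m, hm⟩ := Nat.exists_eq_succ_of_ne_zero hj
    rw [Finset.prod_eq_zero (Finset.mem_univ j), mul_zero]
    simp [hm]
  · intro h
    simp [hn] at h

lemma multiCSum_sub_single_of_notMem {n : ℕ} {s : Finset ι} (φ : (ι → ℕ) → ℝ) (y : ι → ℤ) {j : ι}
    (hj : j ∉ s) : multiCSum n s φ (y - Pi.single j 1) = multiCSum n s φ y := by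
  refine Finset.sum_congr rfl fun b hb => ?_
  congr 1
  refine Finset.prod_congr rfl fun k _ => ?_
  by_cases hk : k = j
  · subst hk
    simp [(Finset.mem_filter.1 hb).2 k hj]
  · simp [hk]

/-- `φ` vanishes on the vectors supported on `s` having an entry at least `n`. -/
def BoundedOn (n : ℕ) (s : Finset ι) (φ : (ι → ℕ) → ℝ) : Prop :=
  ∀ b, (∀ j ∉ s, b j = 0) → φ b ≠ 0 → ∀ j, b j < n

lemma multiCSum_sub_single {n : ℕ} {s : Finset ι} {φ : (ι → ℕ) → ℝ} (hφ : BoundedOn n s φ)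
    (y : ι → ℤ) {j : ι} (hj : j ∈ s) :
    multiCSum n s φ y - multiCSum n s φ (y - Pi.single j 1)
      = multiCSum n s (fun b => φ (b + Pi.single j 1)) y := by
  rw [multiCSum, multiCSum, ← Finset.sum_sub_distrib]
  have key : ∀ b : ι → ℕ, φ (b + Pi.single j 1) * ∏ k, multiC (y k) ((b + Pi.single j 1 : ι → ℕ) k)
      - φ (b + Pi.single j 1) *
        ∏ k, multiC ((y - Pi.single j 1 : ι → ℤ) k) ((b + Pi.single j 1 : ι → ℕ) k)
      = φ (b + Pi.single j 1) * ∏ k, multiC (y k) (b k) := by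
    intro b
    rw [← mul_sub]
    congr 1
    have hsplit : ∀ (u : ι → ℤ) (v : ι → ℕ), ∏ k, multiC (u k) (v k)
        = multiC (u j) (v j) * ∏ k ∈ univ.erase j, multiC (u k) (v k) :=
      fun u v => (Finset.mul_prod_erase _ _ (Finset.mem_univ j)).symm
    rw [hsplit y, hsplit (y - Pi.single j 1), hsplit y b]
    have h1 : ∀ k ∈ univ.erase j, multiC (y k) ((b + Pi.single j 1 : ι → ℕ) k)
        = multiC (y k) (b k) := fun k hk => by simp [Finset.ne_of_mem_erase hk]
    have h2 : ∀ k ∈ univ.erase j,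
        multiC ((y - Pi.single j 1 : ι → ℤ) k) ((b + Pi.single j 1 : ι → ℕ) k)
        = multiC (y k) (b k) := fun k hk => by simp [Finset.ne_of_mem_erase hk]
    rw [Finset.prod_congr rfl h1, Finset.prod_congr rfl h2, ← sub_mul]
    simp [multiC_succ_sub]
  symm
  refine Finset.sum_bij_ne_zero (fun b _ _ => b + Pi.single j 1) ?_ ?_ ?_ ?_
  · intro b hb hne
    simp only [Finset.mem_filter, Fintype.mem_piFinset, Finset.mem_range] at hb ⊢
    have hs : ∀ k ∉ s, (b + Pi.single j 1 : ι → ℕ) k = 0 := by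
      intro k hk
      have : k ≠ j := fun h => hk (h ▸ hj)
      simp [hb.2 k hk, this]
    exact ⟨hφ _ hs (left_ne_zero_of_mul hne), hs⟩
  · intro b _ _ c _ _ h
    exact add_right_cancel h
  · intro c hc hne
    have hcj : c j ≠ 0 := by
      intro h0
      apply hne
      rw [← mul_sub]
      convert mul_zero _
      rw [sub_eq_zero]
      refine Finset.prod_congr rfl fun k _ => ?_
      by_cases hk : k = j
      · subst hk; simp [h0]
      · simp [hk]
    have hcc : c - Pi.single j 1 + Pi.single j 1 = c := by
      funext k
      by_cases hk : k = j
      · subst hk; simp; omega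
      · simp [hk]
    refine ⟨c - Pi.single j 1, ?_, ?_, hcc⟩
    · simp only [Finset.mem_filter, Fintype.mem_piFinset, Finset.mem_range] at hc ⊢
      exact ⟨fun k => lt_of_le_of_lt (Nat.sub_le _ _) (hc.1 k),
        fun k hk => by simp [hc.2 k hk]⟩
    · rw [← key, hcc]
      exact hne
  · intro b _ _
    exact (key b).symm

/-- A family of functions closed under backward differences is recovered from its values at `0`. -/
lemma eq_multiCSum_of_sub {n : ℕ} (hn : 0 < n) {s : Finset ι} {H : (ι → ℕ) → (ι → ℤ) → ℝ}
    (hmem : ∀ b y, ∀ j ∈ s, H b y - H b (y - Pi.single j 1) = H (b + Pi.single j 1) y)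
    (hnot : ∀ b y, ∀ j ∉ s, H b (y - Pi.single j 1) = H b y)
    (hbdd : ∀ b, BoundedOn n s fun c => H (b + c) 0)
    {m : ℕ} (hvan : ∀ b y, m ≤ ∑ j ∈ s, b j → H b y = 0) (b : ι → ℕ) (y : ι → ℤ) :
    H b y = multiCSum n s (fun c => H (b + c) 0) y := by
  induction h : m - ∑ j ∈ s, b j using Nat.strong_induction_on generalizing b y with
  | _ r ih =>
  subst h
  by_cases hm : m ≤ ∑ j ∈ s, b j
  · rw [hvan b y hm, multiCSum]
    symm
    refine Finset.sum_eq_zero fun c _ => ?_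
    rw [hvan, zero_mul]
    refine hm.trans (Finset.sum_le_sum fun j _ => ?_)
    simp
  rw [← sub_eq_zero]
  refine eq_zero_of_shift_invariant (f := fun y => H b y - multiCSum n s (fun c => H (b + c) 0) y)
    ?_ (fun y j => ?_) y
  · simp [multiCSum_zero_right hn]
  · by_cases hj : j ∈ s
    · have h1 := hmem b y j hj
      have h2 := multiCSum_sub_single (hbdd b) y hj
      have hlt : m - ∑ k ∈ s, (b + Pi.single j 1 : ι → ℕ) k < m - ∑ k ∈ s, b k := by
        have : ∑ k ∈ s, (b + Pi.single j 1 : ι → ℕ) k = ∑ k ∈ s, b k + 1 := by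
          simp [Finset.sum_add_distrib, hj]
        omega
      have h3 := ih _ hlt (b + Pi.single j 1) y rfl
      have h4 : multiCSum n s (fun c => H (b + Pi.single j 1 + c) 0) y
          = multiCSum n s (fun c => H (b + (c + Pi.single j 1)) 0) y :=
        multiCSum_congr (fun c => by rw [add_assoc, add_comm c]) y
      linarith
    · simp only [hnot b y j hj, multiCSum_sub_single_of_notMem _ y hj]

end MultichooseSums

section SubsetSums

variable {α : Type*} [DecidableEq α]

/-- The nonempty subsets of `S`. -/
def nonemptySubsets (S : Finset α) : Finset (Finset α) := S.powerset.erase ∅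

lemma mem_nonemptySubsets {S J : Finset α} : J ∈ nonemptySubsets S ↔ J.Nonempty ∧ J ⊆ S := by
  simp [nonemptySubsets, Finset.nonempty_iff_ne_empty]

/-- The sum of `y` over the nonempty subsets of `U`. -/
def zetaSum {M : Type*} [AddCommMonoid M] (y : Finset α → M) (U : Finset α) : M :=
  ∑ J ∈ nonemptySubsets U, y J

section AddCommMonoid

variable {M : Type*} [AddCommMonoid M]

@[simp] lemma zetaSum_empty (y : Finset α → M) : zetaSum y ∅ = 0 := by
  simp [zetaSum, nonemptySubsets]

@[simp] lemma zetaSum_zero (U : Finset α) : zetaSum (0 : Finset α → M) U = 0 := by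
  simp [zetaSum]

lemma zetaSum_add (y y' : Finset α → M) (U : Finset α) :
    zetaSum (y + y') U = zetaSum y U + zetaSum y' U := by
  simp [zetaSum, Finset.sum_add_distrib]

lemma zetaSum_single (J : Finset α) (a : M) (U : Finset α) :
    zetaSum (Pi.single J a) U = if J ∈ nonemptySubsets U then a else 0 := by
  simp [zetaSum]

variable [PartialOrder M] [IsOrderedAddMonoid M]

lemma zetaSum_mono {y : Finset α → M} (hy : ∀ J, 0 ≤ y J) {U V : Finset α} (h : U ⊆ V) :
    zetaSum y U ≤ zetaSum y V := by
  refine Finset.sum_le_sum_of_subset_of_nonneg (fun J hJ => ?_) fun J _ _ => hy J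
  rw [mem_nonemptySubsets] at hJ ⊢
  exact ⟨hJ.1, hJ.2.trans h⟩

lemma zetaSum_supermodular {y : Finset α → M} (hy : ∀ J, 0 ≤ y J) (A B : Finset α) :
    zetaSum y A + zetaSum y B ≤ zetaSum y (A ∪ B) + zetaSum y (A ∩ B) := by
  have h : nonemptySubsets A ∩ nonemptySubsets B = nonemptySubsets (A ∩ B) := by
    ext J
    simp only [Finset.mem_inter, mem_nonemptySubsets, Finset.subset_inter_iff]
    tauto
  rw [zetaSum, zetaSum, ← Finset.sum_union_inter, h]
  refine add_le_add_left
    (Finset.sum_le_sum_of_subset_of_nonneg (fun J hJ => ?_) fun J _ _ => hy J) _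
  simp only [Finset.mem_union, mem_nonemptySubsets] at hJ ⊢
  rcases hJ with hJ | hJ
  · exact ⟨hJ.1, hJ.2.trans Finset.subset_union_left⟩
  · exact ⟨hJ.1, hJ.2.trans Finset.subset_union_right⟩

end AddCommMonoid

/-- The image of `J` under the map identifying `j` with `i`. -/
def merge (i j : α) (J : Finset α) : Finset α := if j ∈ J then insert i (J.erase j) else J

/-- The preimage of `U` under the map identifying `j` with `i`, when `j ∉ U`. -/
def unmerge (i j : α) (U : Finset α) : Finset α := if i ∈ U then insert j U else U

lemma merge_mem_nonemptySubsets {i j : α} {U : Finset α} (hj : j ∉ U)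
    (J : Finset α) : merge i j J ∈ nonemptySubsets U ↔ J ∈ nonemptySubsets (unmerge i j U) := by
  simp only [mem_nonemptySubsets]
  refine and_congr ?_ ?_
  · unfold merge
    split_ifs with h
    · simp [show J.Nonempty from ⟨j, h⟩]
    · rfl
  · simp only [merge, unmerge, Finset.subset_iff]
    split_ifs with h1 h2 h2 <;> simp only [Finset.mem_insert, Finset.mem_erase] <;> grind

lemma unmerge_erase {i j : α} (hij : i ≠ j) {S : Finset α} (hi : i ∈ S) (hj : j ∈ S) :
    unmerge i j (S.erase j) = S := by
  simp [unmerge, hij, hi, hj]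

section Push

variable [Fintype α]

/-- The pushforward of a vector indexed by subsets along a map on subsets. -/
def push {M : Type*} [AddCommMonoid M] (p : Finset α → Finset α) (y : Finset α → M)
    (K : Finset α) : M := ∑ J with p J = K, y J

variable {M : Type*}

lemma push_add [AddCommMonoid M] (p : Finset α → Finset α) (y y' : Finset α → M) :
    push p (y + y') = push p y + push p y' := by
  funext K
  simp [push, Finset.sum_add_distrib]

@[simp] lemma push_zero [AddCommMonoid M] (p : Finset α → Finset α) :
    push p (0 : Finset α → M) = 0 := by
  funext K
  simp [push]

lemma push_single [AddCommMonoid M] (p : Finset α → Finset α) (J : Finset α) (a : M) :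
    push p (Pi.single J a) = Pi.single (p J) a := by
  funext K
  simp [push, Pi.single_apply, eq_comm]

lemma push_sub_single [AddCommGroup M] (p : Finset α → Finset α) (y : Finset α → M)
    (J : Finset α) (a : M) : push p (y - Pi.single J a) = push p y - Pi.single (p J) a := by
  rw [eq_sub_iff_add_eq, ← push_single, ← push_add, sub_add_cancel]

lemma zetaSum_push [AddCommMonoid M] (p : Finset α → Finset α) (y : Finset α → M)
    (U : Finset α) : zetaSum (push p y) U = ∑ J with p J ∈ nonemptySubsets U, y J :=
  Finset.sum_fiberwise_eq_sum_filter _ _ _ _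

lemma zetaSum_push_sdiff [AddCommMonoid M] (y : Finset α → M) (T U : Finset α) :
    zetaSum (push (fun J => J \ T) y) U + zetaSum y T = zetaSum y (U ∪ T) := by
  rw [zetaSum_push, zetaSum, zetaSum, ← Finset.sum_union]
  · refine Finset.sum_congr ?_ fun _ _ => rfl
    ext J
    simp only [Finset.mem_union, Finset.mem_filter, Finset.mem_univ, true_and,
      mem_nonemptySubsets, Finset.sdiff_nonempty]
    constructor
    · rintro (⟨h1, h2⟩ | ⟨h1, h2⟩)
      · refine ⟨Finset.nonempty_iff_ne_empty.2 fun h => h1 (by simp [h]), ?_⟩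
        exact sdiff_le_iff'.1 h2
      · exact ⟨h1, h2.trans Finset.subset_union_right⟩
    · rintro ⟨h1, h2⟩
      by_cases h : J ⊆ T
      · exact Or.inr ⟨h1, h⟩
      · exact Or.inl ⟨h, sdiff_le_iff'.2 h2⟩
  · rw [Finset.disjoint_left]
    intro J h1 h2
    simp only [Finset.mem_filter, Finset.mem_univ, true_and, mem_nonemptySubsets,
      Finset.sdiff_nonempty] at h1 h2
    exact h1.1 h2.2

lemma zetaSum_push_merge [AddCommMonoid M] {i j : α} (y : Finset α → M)
    {U : Finset α} (hj : j ∉ U) :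
    zetaSum (push (merge i j) y) U = zetaSum y (unmerge i j U) := by
  rw [zetaSum_push, zetaSum]
  refine Finset.sum_congr ?_ fun _ _ => rfl
  ext J
  simp [merge_mem_nonemptySubsets hj]

end Push

/-- The dragon marriage condition on `S` for the multiplicities `b`. -/
def Draconian (S : Finset α) (b : Finset α → ℕ) : Prop :=
  ∀ U ⊆ S, U.Nonempty → zetaSum b U + 1 ≤ #U

/-- The dragon marriage condition on `S`, with equality for `S` itself. -/
def FullDraconian (S : Finset α) (b : Finset α → ℕ) : Prop :=
  Draconian S b ∧ zetaSum b S + 1 = #S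

/-- The indicator of the dragon marriage condition. -/
noncomputable def draconianInd (S : Finset α) (b : Finset α → ℕ) : ℝ :=
  if Draconian S b then 1 else 0

/-- The indicator of the full dragon marriage condition. -/
noncomputable def fullDraconianInd (S : Finset α) (b : Finset α → ℕ) : ℝ :=
  if FullDraconian S b then 1 else 0

lemma zetaSum_add_single_of_notMem {S U J : Finset α} (b : Finset α → ℕ)
    (hJ : J ∉ nonemptySubsets S) (hU : U ⊆ S) (a : ℕ) :
    zetaSum (b + Pi.single J a) U = zetaSum b U := by
  rw [zetaSum_add, zetaSum_single, if_neg, add_zero]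
  intro h
  rw [mem_nonemptySubsets] at h hJ
  exact hJ ⟨h.1, h.2.trans hU⟩

lemma draconian_add_single_of_notMem {S J : Finset α} (b : Finset α → ℕ)
    (hJ : J ∉ nonemptySubsets S) (a : ℕ) : Draconian S (b + Pi.single J a) ↔ Draconian S b := by
  refine forall_congr' fun U => forall_congr' fun hU => ?_
  rw [zetaSum_add_single_of_notMem b hJ hU]

lemma fullDraconian_add_single_of_notMem {S J : Finset α} (b : Finset α → ℕ)
    (hJ : J ∉ nonemptySubsets S) (a : ℕ) :
    FullDraconian S (b + Pi.single J a) ↔ FullDraconian S b := by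
  rw [FullDraconian, FullDraconian, draconian_add_single_of_notMem b hJ,
    zetaSum_add_single_of_notMem b hJ subset_rfl]

lemma Draconian.lt_card [Fintype α] {S : Finset α} {b : Finset α → ℕ} (h : Draconian S b)
    {J : Finset α} (hJ : J ∈ nonemptySubsets S) : b J < Fintype.card α := by
  have hJ' := mem_nonemptySubsets.1 hJ
  have h1 := h J hJ'.2 hJ'.1
  have h2 : b J ≤ zetaSum b J := Finset.single_le_sum (f := b) (fun _ _ => Nat.zero_le _)
    (mem_nonemptySubsets.2 ⟨hJ'.1, subset_rfl⟩)
  have h3 := Finset.card_le_univ J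
  omega

lemma draconian_push_sdiff_iff [Fintype α] {S T : Finset α} {b : Finset α → ℕ} (hTS : T ⊆ S)
    (hT : zetaSum b T + 1 = #T) :
    Draconian (S \ T) (push (fun J => J \ T) b) ↔
      ∀ W ⊆ S, T ⊂ W → zetaSum b W + 2 ≤ #W := by
  constructor
  · intro h W hW hTW
    have h1 := h (W \ T) (Finset.sdiff_subset_sdiff hW subset_rfl)
      (Finset.sdiff_nonempty.2 hTW.2)
    have h2 := zetaSum_push_sdiff b T (W \ T)
    rw [Finset.sdiff_union_of_subset hTW.1] at h2
    have h3 := Finset.card_sdiff_add_card_eq_card hTW.1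
    omega
  · intro h U hU hne
    have hdis : Disjoint U T := Finset.disjoint_of_subset_left hU Finset.sdiff_disjoint
    have h1 := h (U ∪ T) (Finset.union_subset (hU.trans Finset.sdiff_subset) hTS) ?_
    · have h2 := zetaSum_push_sdiff b T U
      rw [Finset.card_union_of_disjoint hdis] at h1
      omega
    · refine Finset.ssubset_iff_subset_ne.2 ⟨Finset.subset_union_right, fun h => ?_⟩
      obtain ⟨x, hx⟩ := hne
      exact Finset.disjoint_left.1 hdis hx (h ▸ Finset.mem_union_left T hx)

lemma draconian_of_fullDraconian_of_push_sdiff [Fintype α] {S T : Finset α} {b : Finset α → ℕ}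
    (hTS : T ⊆ S) (hT : FullDraconian T b)
    (h : Draconian (S \ T) (push (fun J => J \ T) b)) : Draconian S b := by
  intro U hU hne
  by_cases hUT : U ⊆ T
  · exact hT.1 U hUT hne
  have h1 := (draconian_push_sdiff_iff hTS hT.2).1 h (U ∪ T) (Finset.union_subset hU hTS)
    (Finset.ssubset_iff_subset_ne.2 ⟨Finset.subset_union_right, fun h =>
      hUT (h ▸ Finset.subset_union_left)⟩)
  have h2 := zetaSum_supermodular (fun J => Nat.zero_le (b J)) U T
  have h3 := Finset.card_union_add_card_inter U T
  have h4 := hT.2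
  by_cases hi : (U ∩ T).Nonempty
  · have h5 := hT.1 _ Finset.inter_subset_right hi
    omega
  · rw [Finset.not_nonempty_iff_eq_empty] at hi
    rw [hi] at h2 h3
    simp only [zetaSum_empty, Finset.card_empty] at h2 h3
    omega

lemma draconian_push_merge_iff [Fintype α] {S : Finset α} {i j : α} (hij : i ≠ j) (hi : i ∈ S)
    (hj : j ∈ S) {b : Finset α → ℕ} :
    Draconian (S.erase j) (push (merge i j) b) ↔
      Draconian S b ∧ ∀ W ⊆ S, i ∈ W → j ∈ W → zetaSum b W + 2 ≤ #W := by
  constructor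
  · intro h
    have hboth : ∀ W ⊆ S, i ∈ W → j ∈ W → zetaSum b W + 2 ≤ #W := by
      intro W hW hiW hjW
      have h1 := h (W.erase j) (Finset.erase_subset_erase j hW) ⟨i, by simp [hij, hiW]⟩
      rw [zetaSum_push_merge b (Finset.notMem_erase j W), unmerge_erase hij hiW hjW] at h1
      have := Finset.card_erase_add_one hjW
      omega
    refine ⟨fun U hU hne => ?_, hboth⟩
    have hmono := fun V hV => zetaSum_mono (fun J => Nat.zero_le (b J)) (U := U) (V := V) hV
    by_cases hiU : i ∈ U <;> by_cases hjU : j ∈ U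
    · have := hboth U hU hiU hjU
      omega
    · have h1 := hboth (insert j U) (Finset.insert_subset hj hU) (by simp [hiU]) (by simp)
      have h2 := hmono _ (Finset.subset_insert j U)
      rw [Finset.card_insert_of_notMem hjU] at h1
      omega
    · have h1 := hboth (insert i U) (Finset.insert_subset hi hU) (by simp) (by simp [hjU])
      have h2 := hmono _ (Finset.subset_insert i U)
      rw [Finset.card_insert_of_notMem hiU] at h1
      omega
    · have h1 := h U (Finset.subset_erase.2 ⟨hU, hjU⟩) hne
      rwa [zetaSum_push_merge b hjU, unmerge, if_neg hiU] at h1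
  · rintro ⟨h, hboth⟩ U hU hne
    obtain ⟨hUS, hjU⟩ := Finset.subset_erase.1 hU
    rw [zetaSum_push_merge b hjU, unmerge]
    split_ifs with hiU
    · have h1 := hboth (insert j U) (Finset.insert_subset hj hUS) (by simp [hiU]) (by simp)
      rw [Finset.card_insert_of_notMem hjU] at h1
      omega
    · exact h U hUS hne

lemma draconian_add_single_iff {S I : Finset α} (hI : I.Nonempty) {b : Finset α → ℕ} :
    Draconian S (b + Pi.single I 1) ↔
      Draconian S b ∧ ∀ W ⊆ S, I ⊆ W → zetaSum b W + 2 ≤ #W := by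
  have key : ∀ W, zetaSum (b + Pi.single I 1) W = zetaSum b W + if I ⊆ W then 1 else 0 := by
    intro W
    simp [zetaSum_add, zetaSum_single, mem_nonemptySubsets, hI]
  constructor
  · intro h
    refine ⟨fun U hU hne => ?_, fun W hW hIW => ?_⟩
    · have := h U hU hne
      rw [key] at this
      omega
    · have := h W hW (hI.mono hIW)
      rw [key, if_pos hIW] at this
      omega
  · rintro ⟨h, h'⟩ U hU hne
    rw [key]
    split_ifs with hIU
    · exact h' U hU hIU
    · exact h U hU hne

/-- The dragon marriage indicator satisfies the recursion governing lattice point counts. -/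
lemma draconian_indicator_recursion [Fintype α] {S I : Finset α} {i j : α} (hij : i ≠ j)
    (hi : i ∈ I) (hj : j ∈ I) (hIS : I ⊆ S) (b : Finset α → ℕ) :
    draconianInd S (b + Pi.single I 1)
      = draconianInd (S.erase j) (push (merge i j) b)
        + ∑ T ∈ S.powerset with i ∈ T ∧ j ∈ T ∧ ¬ I ⊆ T,
          fullDraconianInd T b * draconianInd (S \ T) (push (fun J => J \ T) b) := by
  simp only [draconianInd, fullDraconianInd]
  rw [draconian_push_merge_iff hij (hIS hi) (hIS hj), draconian_add_single_iff ⟨i, hi⟩]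
  by_cases hD : Draconian S b
  swap
  · rw [if_neg fun h => hD h.1, if_neg fun h => hD h.1, Finset.sum_eq_zero, add_zero]
    intro T hT
    rw [Finset.mem_filter, Finset.mem_powerset] at hT
    by_cases h1 : FullDraconian T b
    · rw [if_neg fun h => hD (draconian_of_fullDraconian_of_push_sdiff hT.1 h1 h), mul_zero]
    · rw [if_neg h1, zero_mul]
  by_cases htight : ∃ W ⊆ S, i ∈ W ∧ j ∈ W ∧ zetaSum b W + 1 = #W
  swap
  · push Not at htight
    have h2 : ∀ W ⊆ S, i ∈ W → j ∈ W → zetaSum b W + 2 ≤ #W := by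
      intro W hW hiW hjW
      have h1 := hD W hW ⟨i, hiW⟩
      have h2 := htight W hW hiW hjW
      omega
    rw [if_pos ⟨hD, fun W hW hIW => h2 W hW (hIW hi) (hIW hj)⟩, if_pos ⟨hD, h2⟩,
      Finset.sum_eq_zero, add_zero]
    intro T hT
    rw [Finset.mem_filter, Finset.mem_powerset] at hT
    rw [if_neg fun h => htight T hT.1 hT.2.1 hT.2.2.1 h.2, zero_mul]
  obtain ⟨T, hTmem, hTmax⟩ := (S.powerset.filter fun W => i ∈ W ∧ j ∈ W ∧
    zetaSum b W + 1 = #W).exists_max_image Finset.card (by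
      obtain ⟨W, hW⟩ := htight
      exact ⟨W, by simpa using hW⟩)
  simp only [Finset.mem_filter, Finset.mem_powerset] at hTmem hTmax
  obtain ⟨hTS, hiT, hjT, hT⟩ := hTmem
  have hTtop : ∀ W ⊆ S, i ∈ W → j ∈ W → zetaSum b W + 1 = #W → W ⊆ T := by
    intro W hW hiW hjW hWt
    have h1 := hD (W ∪ T) (Finset.union_subset hW hTS) ⟨i, by simp [hiT]⟩
    have h2 := hD (W ∩ T) (Finset.inter_subset_left.trans hW) ⟨i, by simp [hiT, hiW]⟩
    have h3 := zetaSum_supermodular (fun J => Nat.zero_le (b J)) W T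
    have h4 := Finset.card_union_add_card_inter W T
    have h5 := hTmax (W ∪ T) ⟨Finset.union_subset hW hTS, by simp [hiT], by simp [hjT], by omega⟩
    rw [Finset.eq_of_subset_of_card_le Finset.subset_union_right h5]
    exact Finset.subset_union_left
  rw [if_neg (c := Draconian S b ∧ ∀ W ⊆ S, i ∈ W → j ∈ W → _) (fun h => by
    have := h.2 T hTS hiT hjT; omega), zero_add]
  have hfull : FullDraconian T b := ⟨fun U hU hne => hD U (hU.trans hTS) hne, hT⟩
  have hquot : Draconian (S \ T) (push (fun J => J \ T) b) := by
    rw [draconian_push_sdiff_iff hTS hT]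
    intro W hW hTW
    have h1 := hD W hW ⟨i, hTW.1 hiT⟩
    have h2 : zetaSum b W + 1 ≠ #W := fun h =>
      hTW.2 (hTtop W hW (hTW.1 hiT) (hTW.1 hjT) h)
    omega
  have hother : ∀ W ∈ S.powerset.filter (fun T => i ∈ T ∧ j ∈ T ∧ ¬ I ⊆ T), W ≠ T →
      (if FullDraconian W b then 1 else 0 : ℝ) *
        (if Draconian (S \ W) (push (fun J => J \ W) b) then 1 else 0) = 0 := by
    intro W hW hne
    rw [Finset.mem_filter, Finset.mem_powerset] at hW
    by_cases hWf : FullDraconian W b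
    · have hsub := hTtop W hW.1 hW.2.1 hW.2.2.1 hWf.2
      rw [if_pos hWf, one_mul, draconian_push_sdiff_iff hW.1 hWf.2, if_neg]
      intro h
      have := h T hTS (Finset.ssubset_iff_subset_ne.2 ⟨hsub, hne⟩)
      omega
    · rw [if_neg hWf, zero_mul]
  by_cases hIT : I ⊆ T
  · rw [if_neg (fun h => by have := h.2 T hTS hIT; omega), Finset.sum_eq_zero]
    intro W hW
    refine hother W hW fun h => ?_
    rw [Finset.mem_filter] at hW
    exact hW.2.2.2 (h ▸ hIT)
  · rw [Finset.sum_eq_single_of_mem T (by simp [hTS, hiT, hjT, hIT]) hother, if_pos hfull,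
      if_pos hquot, mul_one, if_pos]
    refine ⟨hD, fun W hW hIW => ?_⟩
    have h1 := hD W hW ⟨i, hIW hi⟩
    have h2 : zetaSum b W + 1 ≠ #W := fun h =>
      hIT (hIW.trans (hTtop W hW (hIW hi) (hIW hj) h))
    omega

lemma not_draconian_add {S : Finset α} (hS : S.Nonempty) {b : Finset α → ℕ} (h : #S ≤ zetaSum b S)
    (c : Finset α → ℕ) : ¬ Draconian S (b + c) := by
  intro hD
  have := hD S subset_rfl hS
  rw [zetaSum_add] at this
  omega

lemma sdiff_mem_nonemptySubsets {S T J : Finset α} (hTS : T ⊆ S) :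
    J \ T ∈ nonemptySubsets (S \ T) ↔ J ⊆ S ∧ ¬ J ⊆ T := by
  rw [mem_nonemptySubsets, Finset.sdiff_nonempty, and_comm]
  refine and_congr_left fun _ => ?_
  constructor
  · intro h x hx
    by_cases hxT : x ∈ T
    · exact hTS hxT
    · exact (Finset.mem_sdiff.1 (h (Finset.mem_sdiff.2 ⟨hx, hxT⟩))).1
  · exact fun h => Finset.sdiff_subset_sdiff h subset_rfl

end SubsetSums

section DraconianSums

variable {α : Type*} [DecidableEq α] [Fintype α]

/-- The sum of `∏ C(y_J + b_J - 1, b_J)` over the draconian vectors `b` on `S`. -/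
noncomputable def draconianSum (S : Finset α) (y : Finset α → ℤ) : ℝ :=
  multiCSum (Fintype.card α) (nonemptySubsets S) (draconianInd S) y

/-- The sum of `∏ C(y_J + b_J - 1, b_J)` over the draconian vectors `b` on `S` of full size. -/
noncomputable def fullDraconianSum (S : Finset α) (y : Finset α → ℤ) : ℝ :=
  multiCSum (Fintype.card α) (nonemptySubsets S) (fullDraconianInd S) y

lemma boundedOn_draconian [Nonempty α] (S : Finset α) (b : Finset α → ℕ) :
    BoundedOn (Fintype.card α) (nonemptySubsets S)
      fun c => draconianInd S (b + c) := by
  intro c hc hne J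
  by_cases hJ : J ∈ nonemptySubsets S
  · have h : Draconian S (b + c) := by
      by_contra h
      exact hne (if_neg h)
    have h1 := h.lt_card hJ
    rw [Pi.add_apply] at h1
    omega
  · rw [hc J hJ]
    exact Fintype.card_pos

lemma boundedOn_fullDraconian [Nonempty α] (S : Finset α) (b : Finset α → ℕ) :
    BoundedOn (Fintype.card α) (nonemptySubsets S)
      fun c => fullDraconianInd S (b + c) := by
  intro c hc hne
  refine boundedOn_draconian S b c hc fun h => hne ?_
  simp only [draconianInd, fullDraconianInd, ite_eq_right_iff, one_ne_zero, imp_false] at h ⊢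
  exact fun h' => h h'.1

lemma multiCSum_draconian_add_eq_zero {S : Finset α} (hS : S.Nonempty) {b : Finset α → ℕ}
    (h : #S ≤ zetaSum b S) (n : ℕ) (y : Finset α → ℤ) :
    multiCSum n (nonemptySubsets S) (fun c => draconianInd S (b + c)) y = 0 :=
  Finset.sum_eq_zero fun c _ => by simp [draconianInd, not_draconian_add hS h c]

lemma multiCSum_fullDraconian_add_eq_zero {S : Finset α} (hS : S.Nonempty) {b : Finset α → ℕ}
    (h : #S ≤ zetaSum b S) (n : ℕ) (y : Finset α → ℤ) :
    multiCSum n (nonemptySubsets S) (fun c => fullDraconianInd S (b + c)) y = 0 :=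
  Finset.sum_eq_zero fun c _ => by
    simp [fullDraconianInd, FullDraconian, not_draconian_add hS h c]

lemma multiCSum_push_sub_single {n : ℕ} {s : Finset (Finset α)} {ψ : (Finset α → ℕ) → ℝ}
    {p : Finset α → Finset α} (b : Finset α → ℕ) (hψ : BoundedOn n s fun c => ψ (push p b + c))
    (y : Finset α → ℤ) {J : Finset α} (hJ : p J ∈ s) :
    multiCSum n s (fun c => ψ (push p b + c)) (push p y)
      - multiCSum n s (fun c => ψ (push p b + c)) (push p (y - Pi.single J 1))
      = multiCSum n s (fun c => ψ (push p (b + Pi.single J 1) + c)) (push p y) := by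
  rw [push_sub_single, multiCSum_sub_single hψ _ hJ, push_add, push_single]
  exact multiCSum_congr (fun c => by rw [add_assoc, add_comm c]) _

lemma multiCSum_push_sub_single_of_notMem {n : ℕ} {s : Finset (Finset α)}
    (φ : (Finset α → ℕ) → ℝ) {p : Finset α → Finset α} (y : Finset α → ℤ) {J : Finset α}
    (hJ : p J ∉ s) :
    multiCSum n s φ (push p (y - Pi.single J 1)) = multiCSum n s φ (push p y) := by
  rw [push_sub_single, multiCSum_sub_single_of_notMem _ _ hJ]

lemma draconianSum_sub_single {S I : Finset α} {i j : α} (hij : i ≠ j)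
    (hi : i ∈ I) (hj : j ∈ I) (hIS : I ⊆ S) (y : Finset α → ℤ) :
    draconianSum S y - draconianSum S (y - Pi.single I 1)
      = draconianSum (S.erase j) (push (merge i j) y)
        + ∑ T ∈ S.powerset with i ∈ T ∧ j ∈ T ∧ ¬ I ⊆ T,
          fullDraconianSum T y * draconianSum (S \ T) (push (fun J => J \ T) y) := by
  have : Nonempty α := ⟨i⟩
  set n := Fintype.card α
  have hn : 0 < n := Fintype.card_pos
  set Q : Finset (Finset α) := S.powerset.filter fun T => i ∈ T ∧ j ∈ T ∧ ¬ I ⊆ T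
  have hQ : ∀ T ∈ Q, T ⊆ S ∧ i ∈ T ∧ j ∈ T ∧ ¬ I ⊆ T := fun T hT => by simpa [Q] using hT
  set H : (Finset α → ℕ) → (Finset α → ℤ) → ℝ := fun b y =>
    multiCSum n (nonemptySubsets (S.erase j))
      (fun c => draconianInd (S.erase j) (push (merge i j) b + c))
      (push (merge i j) y)
    + ∑ T ∈ Q, multiCSum n (nonemptySubsets T)
        (fun c => fullDraconianInd T (b + c)) y *
      multiCSum n (nonemptySubsets (S \ T))
        (fun c => draconianInd (S \ T) (push (fun J => J \ T) b + c))
        (push (fun J => J \ T) y) with hH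
  have hmerge : ∀ J, merge i j J ∈ nonemptySubsets (S.erase j) ↔ J ∈ nonemptySubsets S := by
    intro J
    rw [merge_mem_nonemptySubsets (Finset.notMem_erase j S), unmerge_erase hij (hIS hi) (hIS hj)]
  have hmem : ∀ b y, ∀ J ∈ nonemptySubsets S,
      H b y - H b (y - Pi.single J 1) = H (b + Pi.single J 1) y := by
    intro b y J hJ
    simp only [hH]
    rw [add_sub_add_comm, multiCSum_push_sub_single b (boundedOn_draconian _ _) y ((hmerge J).2 hJ),
      ← Finset.sum_sub_distrib]
    congr 1
    refine Finset.sum_congr rfl fun T hT => ?_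
    obtain ⟨hTS, -⟩ := hQ T hT
    rw [mem_nonemptySubsets] at hJ
    by_cases hJT : J ⊆ T
    · have h1 : J \ T ∉ nonemptySubsets (S \ T) := by
        rw [sdiff_mem_nonemptySubsets hTS]
        tauto
      rw [multiCSum_push_sub_single_of_notMem (p := fun J => J \ T) _ y h1, ← sub_mul,
        multiCSum_sub_single (boundedOn_fullDraconian _ _) y (mem_nonemptySubsets.2 ⟨hJ.1, hJT⟩)]
      congr 1
      · exact multiCSum_congr (fun c => by rw [add_assoc, add_comm c]) _
      · refine multiCSum_congr (fun c => ?_) _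
        rw [push_add, push_single, add_right_comm, draconianInd, draconianInd,
          draconian_add_single_of_notMem _ h1]
    · have h1 : J ∉ nonemptySubsets T := by
        rw [mem_nonemptySubsets]
        tauto
      rw [multiCSum_sub_single_of_notMem _ y h1, ← mul_sub,
        multiCSum_push_sub_single (p := fun J => J \ T) b (boundedOn_draconian _ _) y
          ((sdiff_mem_nonemptySubsets hTS).2 ⟨hJ.2, hJT⟩)]
      congr 1
      refine multiCSum_congr (fun c => ?_) _
      rw [add_right_comm, fullDraconianInd, fullDraconianInd,
        fullDraconian_add_single_of_notMem _ h1]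
  have hnot : ∀ b y, ∀ J ∉ nonemptySubsets S, H b (y - Pi.single J 1) = H b y := by
    intro b y J hJ
    simp only [hH]
    rw [multiCSum_push_sub_single_of_notMem _ y (fun h => hJ ((hmerge J).1 h))]
    congr 1
    refine Finset.sum_congr rfl fun T hT => ?_
    obtain ⟨hTS, -⟩ := hQ T hT
    rw [mem_nonemptySubsets] at hJ
    rw [multiCSum_push_sub_single_of_notMem (p := fun J => J \ T),
      multiCSum_sub_single_of_notMem]
    · rw [mem_nonemptySubsets]
      exact fun h => hJ ⟨h.1, h.2.trans hTS⟩
    · rw [sdiff_mem_nonemptySubsets hTS]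
      rintro ⟨h1, h2⟩
      refine hJ ⟨Finset.nonempty_iff_ne_empty.2 ?_, h1⟩
      rintro rfl
      exact h2 (Finset.empty_subset T)
  have hvan : ∀ b y, #S ≤ ∑ J ∈ nonemptySubsets S, b J → H b y = 0 := by
    intro b y hb
    change #S ≤ zetaSum b S at hb
    simp only [hH]
    rw [multiCSum_draconian_add_eq_zero, zero_add, Finset.sum_eq_zero]
    · intro T hT
      obtain ⟨hTS, hiT, -, hIT⟩ := hQ T hT
      have h1 := zetaSum_push_sdiff b T (S \ T)
      rw [Finset.sdiff_union_of_subset hTS] at h1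
      have h2 := Finset.card_sdiff_add_card_eq_card hTS
      by_cases h : #T ≤ zetaSum b T
      · rw [multiCSum_fullDraconian_add_eq_zero ⟨i, hiT⟩ h, zero_mul]
      · rw [multiCSum_draconian_add_eq_zero, mul_zero]
        · exact Finset.sdiff_nonempty.2 fun h => hIT (hIS.trans h)
        · omega
    · exact ⟨i, by simp [hij, hIS hi]⟩
    · rw [zetaSum_push_merge b (Finset.notMem_erase j S), unmerge_erase hij (hIS hi) (hIS hj)]
      exact (Finset.card_erase_le).trans hb
  have hzero : ∀ b, H b 0 = draconianInd S (b + Pi.single I 1) := by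
    intro b
    rw [draconian_indicator_recursion hij hi hj hIS b]
    simp only [hH, push_zero, multiCSum_zero_right hn, add_zero]
    rfl
  have hbdd : ∀ b, BoundedOn n (nonemptySubsets S) fun c => H (b + c) 0 := by
    intro b
    simp only [hzero]
    have h : ∀ c, b + c + Pi.single I 1 = b + Pi.single I 1 + c := fun c => add_right_comm _ _ _
    simp only [h]
    exact boundedOn_draconian S (b + Pi.single I 1)
  have hbdd0 := boundedOn_draconian S (0 : Finset α → ℕ)
  simp only [zero_add] at hbdd0
  have hIS' : I ∈ nonemptySubsets S := mem_nonemptySubsets.2 ⟨⟨i, hi⟩, hIS⟩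
  have hmain := eq_multiCSum_of_sub hn hmem hnot hbdd hvan 0 y
  simp only [zero_add, hzero] at hmain
  rw [draconianSum, draconianSum, multiCSum_sub_single hbdd0 y hIS', ← hmain]
  simp only [hH, push_zero, zero_add]
  rfl

lemma draconianSum_sub_single_eq_of_not_draconian {S I : Finset α}
    (hI : ∀ b : Finset α → ℕ, ¬ Draconian S (b + Pi.single I 1)) (y : Finset α → ℤ) :
    draconianSum S (y - Pi.single I 1) = draconianSum S y := by
  by_cases hα : Nonempty α
  swap
  · have := not_nonempty_iff.1 hα
    simp [draconianSum, multiCSum]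
  by_cases hIS : I ∈ nonemptySubsets S
  · have hbdd0 := boundedOn_draconian S (0 : Finset α → ℕ)
    simp only [zero_add] at hbdd0
    symm
    rw [← sub_eq_zero, draconianSum, draconianSum, multiCSum_sub_single hbdd0 y hIS]
    exact Finset.sum_eq_zero fun b _ => by simp [draconianInd, hI b]
  · exact multiCSum_sub_single_of_notMem _ y hIS

lemma fullDraconianSum_eq [Nonempty α] {S : Finset α} (hS : S.Nonempty) (y : Finset α → ℤ) :
    fullDraconianSum S y = draconianSum S (y - Pi.single S 1) := by
  suffices draconianSum S y - fullDraconianSum S y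
      = draconianSum S y - draconianSum S (y - Pi.single S 1) by linarith
  have hbdd0 := boundedOn_draconian S (0 : Finset α → ℕ)
  simp only [zero_add] at hbdd0
  have hmem : S ∈ nonemptySubsets S := mem_nonemptySubsets.2 ⟨hS, subset_rfl⟩
  rw [draconianSum, draconianSum, multiCSum_sub_single hbdd0 y hmem, fullDraconianSum,
    ← multiCSum_sub]
  refine multiCSum_congr (fun b => ?_) y
  rw [draconianInd, draconianInd, fullDraconianInd, draconian_add_single_iff hS, FullDraconian]
  by_cases hD : Draconian S b
  · have h1 := hD S subset_rfl hS
    by_cases hfull : zetaSum b S + 1 = #S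
    · rw [if_pos hD, if_pos ⟨hD, hfull⟩, if_neg, sub_self]
      exact fun h => by have := h.2 S subset_rfl subset_rfl; omega
    · rw [if_pos hD, if_neg fun h => hfull h.2, if_pos, sub_zero]
      refine ⟨hD, fun W hW hSW => ?_⟩
      rw [hW.antisymm hSW]
      omega
  · rw [if_neg hD, if_neg fun h => hD h.1, if_neg fun h => hD h.1, sub_self]

end DraconianSums

section BasePoints

variable {α : Type*}

/-- The integer points of the base polytope of `z` on the ground set `S`. -/
def basePts (S : Finset α) (z : Finset α → ℤ) : Set (α → ℤ) :=
  {x | (∀ k ∉ S, x k = 0) ∧ ∑ k ∈ S, x k = z S ∧ ∀ U ⊆ S, z U ≤ ∑ k ∈ U, x k}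

lemma basePts_congr {S : Finset α} {z z' : Finset α → ℤ} (h : ∀ U ⊆ S, z U = z' U) :
    basePts S z = basePts S z' := by
  ext x
  simp only [basePts, Set.mem_ofPred_eq]
  rw [h S subset_rfl]
  refine and_congr_right fun _ => and_congr_right fun _ => ?_
  exact forall_congr' fun U => forall_congr' fun hU => by rw [h U hU]

variable [DecidableEq α]

/-- The set function `z` is supermodular on the subsets of `S`. -/
def SupermodularOn (S : Finset α) (z : Finset α → ℤ) : Prop :=
  ∀ A ⊆ S, ∀ B ⊆ S, z A + z B ≤ z (A ∪ B) + z (A ∩ B)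

lemma SupermodularOn.mono {S T : Finset α} {z : Finset α → ℤ} (h : SupermodularOn S z)
    (hTS : T ⊆ S) : SupermodularOn T z :=
  fun A hA B hB => h A (hA.trans hTS) B (hB.trans hTS)

lemma finite_basePts [Fintype α] (S : Finset α) (z : Finset α → ℤ) : (basePts S z).Finite := by
  refine (Set.finite_Icc (fun k => if k ∈ S then z {k} else 0)
    (fun k => if k ∈ S then z S - z (S.erase k) else 0)).subset ?_
  rintro x ⟨h0, hS, hU⟩
  rw [Set.mem_Icc, Pi.le_def, Pi.le_def, ← forall_and]
  intro k
  by_cases hk : k ∈ S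
  · have h1 := hU {k} (by simpa using hk)
    have h2 := hU (S.erase k) (Finset.erase_subset _ _)
    have h3 := Finset.sum_erase_add S x hk
    rw [Finset.sum_singleton] at h1
    simp only [hk, if_true]
    omega
  · simp [hk, h0 k hk]

lemma sum_union_add_sum_inter (x : α → ℤ) (A B : Finset α) :
    ∑ k ∈ A ∪ B, x k + ∑ k ∈ A ∩ B, x k = ∑ k ∈ A, x k + ∑ k ∈ B, x k :=
  Finset.sum_union_inter

lemma sum_add_single (x : α → ℤ) (i : α) (a : ℤ) (U : Finset α) :
    ∑ k ∈ U, (x + Pi.single i a : α → ℤ) k = ∑ k ∈ U, x k + if i ∈ U then a else 0 := by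
  simp [Finset.sum_add_distrib]

/-- Every element of the ground set lies in a smallest tight set. -/
lemma exists_least_tight {S : Finset α} {z : Finset α → ℤ} (hz : SupermodularOn S z)
    {x : α → ℤ} (hx : x ∈ basePts S z) {i : α} (hi : i ∈ S) :
    ∃ T ⊆ S, i ∈ T ∧ ∑ k ∈ T, x k = z T ∧
      ∀ U ⊆ S, i ∈ U → ∑ k ∈ U, x k = z U → T ⊆ U := by
  obtain ⟨T, hT, hmin⟩ := (S.powerset.filter fun U => i ∈ U ∧ ∑ k ∈ U, x k = z U).exists_min_image
    Finset.card ⟨S, by simp [hi, hx.2.1]⟩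
  simp only [Finset.mem_filter, Finset.mem_powerset] at hT hmin
  obtain ⟨hTS, hiT, hT⟩ := hT
  refine ⟨T, hTS, hiT, hT, fun U hU hiU hUt => ?_⟩
  have h1 := hz T hTS U hU
  have h2 := hx.2.2 (T ∪ U) (Finset.union_subset hTS hU)
  have h3 := hx.2.2 (T ∩ U) (Finset.inter_subset_left.trans hTS)
  have h4 := sum_union_add_sum_inter x T U
  have h5 := hmin (T ∩ U)
    ⟨Finset.inter_subset_left.trans hTS, by simp [hiT, hiU], by omega⟩
  rw [← Finset.eq_of_subset_of_card_le Finset.inter_subset_left h5]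
  exact Finset.inter_subset_right

variable {S I : Finset α} {z : Finset α → ℤ} {i j : α}

lemma ncard_basePts_sub (hi : i ∈ I) (hIS : I ⊆ S) :
    (basePts S fun U => z U - if I ⊆ U then 1 else 0).ncard
      = {x ∈ basePts S z | ∀ U ⊆ S, i ∈ U → ∑ k ∈ U, x k = z U → I ⊆ U}.ncard := by
  rw [← Set.ncard_image_of_injective _ (add_left_injective (Pi.single i (1 : ℤ)))]
  congr 1
  ext x
  simp only [Set.image_add_right, Set.mem_preimage, basePts, Set.mem_ofPred_eq, ← Pi.single_neg,
    sum_add_single, if_pos hIS, if_pos (hIS hi)]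
  constructor
  · rintro ⟨h0, hS, hU⟩
    refine ⟨⟨fun k hk => ?_, by omega, fun U hUS => ?_⟩, fun U hUS hiU hUt => ?_⟩
    · have hki : k ≠ i := fun h => hk (h ▸ hIS hi)
      simpa [hki] using h0 k hk
    · have h1 := hU U hUS
      by_cases hIU : I ⊆ U
      · simp only [hIU, hIU hi, if_true] at h1
        omega
      · rw [if_neg hIU] at h1
        split_ifs at h1 <;> omega
    · by_contra hIU
      have h1 := hU U hUS
      simp only [hIU, hiU, if_true, if_false] at h1
      omega
  · rintro ⟨⟨h0, hS, hU⟩, ht⟩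
    refine ⟨fun k hk => ?_, by omega, fun U hUS => ?_⟩
    · have hki : k ≠ i := fun h => hk (h ▸ hIS hi)
      simpa [hki] using h0 k hk
    · have h1 := hU U hUS
      have h2 := ht U hUS
      have h3 : I ⊆ U → i ∈ U := fun h => h hi
      by_cases hiU : i ∈ U <;> by_cases hIU : I ⊆ U <;> simp only [hiU, hIU, if_true, if_false]
      · omega
      · have h4 : ∑ k ∈ U, x k ≠ z U := fun h => hIU (h2 hiU h)
        omega
      · exact absurd (h3 hIU) hiU
      · omega

lemma ncard_basePts_unmerge (hij : i ≠ j) (hi : i ∈ S) (hj : j ∈ S) (hz : SupermodularOn S z) :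
    (basePts (S.erase j) fun U => z (unmerge i j U)).ncard
      = {x ∈ basePts S z | ∃ U ⊆ S, i ∈ U ∧ j ∉ U ∧ ∑ k ∈ U, x k = z U}.ncard := by
  symm
  set f : (α → ℤ) → α → ℤ := fun x => (x + Pi.single i (x j) : α → ℤ) + Pi.single j (-x j) with hf
  have hsum : ∀ x U, ∑ k ∈ U, f x k
      = ∑ k ∈ U, x k + (if i ∈ U then x j else 0) + if j ∈ U then -x j else 0 := by
    intro x U
    rw [hf, sum_add_single, sum_add_single]
  have key : ∀ x x' : α → ℤ, x ∈ basePts S z → f x = f x' →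
      (∃ U ⊆ S, i ∈ U ∧ j ∉ U ∧ ∑ k ∈ U, x' k = z U) → x j ≤ x' j := by
    rintro x x' hx hff ⟨U, hU, hiU, hjU, ht⟩
    have h1 := hsum x U
    have h2 := hsum x' U
    have h3 := hx.2.2 U hU
    rw [hff] at h1
    simp only [hiU, hjU, if_true, if_false] at h1 h2
    omega
  refine Set.BijOn.ncard_eq (f := f) ⟨?_, ?_, ?_⟩
  · rintro x ⟨⟨h0, hS, hU⟩, -⟩
    have hle : ∀ U, j ∉ U → ∑ k ∈ U, f x k = ∑ k ∈ unmerge i j U, x k := by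
      intro U hjU
      rw [hsum, if_neg hjU, unmerge]
      split_ifs
      · rw [Finset.sum_insert hjU]
        ring
      · ring
    refine ⟨fun k hk => ?_, ?_, fun U hUS => ?_⟩
    · by_cases hkj : k = j
      · subst hkj
        simp [hf, hij]
      · have hkS : k ∉ S := fun h => hk (by simp [hkj, h])
        have hki : k ≠ i := fun h => hkS (h ▸ hi)
        simp [hf, hkj, hki, h0 k hkS]
    · simp only [hle _ (Finset.notMem_erase j S), unmerge_erase hij hi hj, hS]
    · obtain ⟨hUS, hjU⟩ := Finset.subset_erase.1 hUS
      rw [hle _ hjU]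
      refine hU _ ?_
      rw [unmerge]
      split_ifs
      · exact Finset.insert_subset hj hUS
      · exact hUS
  · rintro x ⟨hx, hxt⟩ x' ⟨hx', hxt'⟩ hff
    have h1 : x j = x' j := le_antisymm (key x x' hx hff hxt') (key x' x hx' hff.symm hxt)
    simpa only [hf, h1, add_left_inj] using hff
  · rintro w ⟨h0, hS, hU⟩
    have hwj : w j = 0 := h0 j (Finset.notMem_erase j S)
    have hboth : ∀ U ⊆ S, (i ∈ U ↔ j ∈ U) → z U ≤ ∑ k ∈ U, w k := by
      intro U hUS hiff
      have h1 := hU (U.erase j) (Finset.erase_subset_erase j hUS)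
      rw [Finset.sum_erase U hwj] at h1
      convert h1 using 2
      by_cases hjU : j ∈ U
      · rw [unmerge_erase hij (hiff.2 hjU) hjU]
      · rw [unmerge, Finset.erase_eq_of_notMem hjU, if_neg fun h => hjU (hiff.1 h)]
    obtain ⟨V, hV, hmin⟩ := (S.powerset.filter fun U => i ∈ U ∧ j ∉ U).exists_min_image
      (fun U => ∑ k ∈ U, w k - z U) ⟨{i}, by simp [hi, hij.symm]⟩
    simp only [Finset.mem_filter, Finset.mem_powerset] at hV hmin
    obtain ⟨hVS, hiV, hjV⟩ := hV
    set t := ∑ k ∈ V, w k - z V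
    have hxsum : ∀ U, ∑ k ∈ U, (w + Pi.single i (-t) + Pi.single j t : α → ℤ) k
        = ∑ k ∈ U, w k + (if i ∈ U then -t else 0) + if j ∈ U then t else 0 := by
      intro U
      rw [sum_add_single, sum_add_single]
    refine ⟨w + Pi.single i (-t) + Pi.single j t, ⟨⟨fun k hk => ?_, ?_, fun U hUS => ?_⟩,
      V, hVS, hiV, hjV, ?_⟩, ?_⟩
    · have hki : k ≠ i := fun h => hk (h ▸ hi)
      have hkj : k ≠ j := fun h => hk (h ▸ hj)
      simp [hki, hkj, h0 k fun h => hk (Finset.mem_of_mem_erase h)]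
    · simp only [Finset.sum_erase S hwj, unmerge_erase hij hi hj] at hS
      rw [hxsum, if_pos hi, if_pos hj, hS]
      ring
    · rw [hxsum]
      by_cases hiU : i ∈ U <;> by_cases hjU : j ∈ U <;> simp only [hiU, hjU, if_true, if_false]
      · have := hboth U hUS (by tauto)
        omega
      · have := hmin U ⟨hUS, hiU, hjU⟩
        omega
      · have h1 := hz U hUS V hVS
        have h2 := hboth (U ∪ V) (Finset.union_subset hUS hVS) (by simp [hiV, hjU])
        have h3 := hboth (U ∩ V) (Finset.inter_subset_left.trans hUS) (by simp [hiU, hjV])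
        have h4 := sum_union_add_sum_inter w U V
        omega
      · have := hboth U hUS (by tauto)
        omega
    · rw [hxsum, if_pos hiV, if_neg hjV]
      omega
    · have h1 : (w + Pi.single i (-t) + Pi.single j t : α → ℤ) j = t := by
        simp [hwj, hij.symm]
      simp only [hf, h1]
      funext k
      simp only [Pi.add_apply, Pi.single_neg, Pi.neg_apply]
      ring

lemma ncard_basePts_prod {T : Finset α} (hiT : i ∈ T) (hTS : T ⊆ S) (hz : SupermodularOn S z) :
    (basePts T fun U => z U - if T ⊆ U then 1 else 0).ncard
        * (basePts (S \ T) fun U => z (U ∪ T) - z T).ncard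
      = {x ∈ basePts S z | ∑ k ∈ T, x k = z T ∧
          ∀ U ⊆ T, i ∈ U → ∑ k ∈ U, x k = z U → U = T}.ncard := by
  rw [← Set.ncard_prod]
  set g : (α → ℤ) × (α → ℤ) → α → ℤ := fun p => p.1 + p.2 + Pi.single i 1 with hg
  rw [← Set.InjOn.ncard_image (f := g)]
  · congr 1
    ext x
    constructor
    · rintro ⟨⟨u, v⟩, ⟨⟨hu0, huT, hu⟩, ⟨hv0, hvT, hv⟩⟩, rfl⟩
      simp only [subset_refl, if_true] at huT hu
      simp only [] at hu0 hv0 hvT hv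
      have hsumu : ∀ U, ∑ k ∈ U, u k = ∑ k ∈ U ∩ T, u k := fun U =>
        (Finset.sum_subset Finset.inter_subset_left fun k hk hk' =>
          hu0 k fun h => hk' (Finset.mem_inter.2 ⟨hk, h⟩)).symm
      have hsumv : ∀ U, ∑ k ∈ U, v k = ∑ k ∈ U \ T, v k := fun U =>
        (Finset.sum_subset Finset.sdiff_subset fun k hk hk' =>
          hv0 k fun h => hk' (Finset.mem_sdiff.2 ⟨hk, (Finset.mem_sdiff.1 h).2⟩)).symm
      have hsum : ∀ U, ∑ k ∈ U, g (u, v) k = ∑ k ∈ U ∩ T, u k + ∑ k ∈ U \ T, v k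
          + if i ∈ U then 1 else 0 := by
        intro U
        rw [hg, sum_add_single]
        simp only [Pi.add_apply, Finset.sum_add_distrib]
        rw [hsumu U, hsumv U]
      refine ⟨⟨fun k hk => ?_, ?_, fun U hU => ?_⟩, ?_, fun U hU hiU hUt => ?_⟩
      · have hki : k ≠ i := fun h => hk (h ▸ hTS hiT)
        simp [hg, hki, hu0 k fun h => hk (hTS h), hv0 k fun h => hk (Finset.mem_sdiff.1 h).1]
      · rw [Finset.sdiff_union_of_subset hTS] at hvT
        rw [hsum, Finset.inter_eq_right.2 hTS, if_pos (hTS hiT)]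
        omega
      · have h1 := hu (U ∩ T) Finset.inter_subset_right
        have h2 := hv (U \ T) (Finset.sdiff_subset_sdiff hU subset_rfl)
        rw [Finset.sdiff_union_self_eq_union] at h2
        have h3 := hz U hU T hTS
        have h4 : T ⊆ U ∩ T → i ∈ U := fun h => (Finset.mem_inter.1 (h hiT)).1
        rw [hsum]
        split_ifs at h1 ⊢ <;> first | omega | tauto
      · rw [hsum, Finset.inter_self, Finset.sdiff_self, if_pos hiT, Finset.sum_empty]
        omega
      · by_contra hne
        have h1 := hu U hU
        rw [if_neg fun h => hne (hU.antisymm h)] at h1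
        rw [hsum, Finset.inter_eq_left.2 hU, Finset.sdiff_eq_empty_iff_subset.2 hU, if_pos hiU,
          Finset.sum_empty] at hUt
        omega
    · rintro ⟨⟨h0, hS, hU⟩, hT, ht⟩
      have hu : ∀ U ⊆ T, ∑ k ∈ U, ((fun k => if k ∈ T then x k else 0) + Pi.single i (-1) : α → ℤ) k
          = ∑ k ∈ U, x k + if i ∈ U then -1 else 0 := by
        intro U hU
        rw [sum_add_single]
        congr 1
        exact Finset.sum_congr rfl fun k hk => if_pos (hU hk)
      have hv : ∀ U ⊆ S \ T, ∑ k ∈ U, (if k ∈ T then 0 else x k)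
          = ∑ k ∈ U ∪ T, x k - ∑ k ∈ T, x k := by
        intro U hU
        rw [Finset.sum_union (Finset.disjoint_of_subset_left hU Finset.sdiff_disjoint),
          add_sub_cancel_right]
        exact Finset.sum_congr rfl fun k hk => if_neg (Finset.mem_sdiff.1 (hU hk)).2
      refine ⟨⟨(fun k => if k ∈ T then x k else 0) + Pi.single i (-1),
        fun k => if k ∈ T then 0 else x k⟩, ⟨⟨fun k hk => ?_, ?_, fun U hUT => ?_⟩,
        ⟨fun k hk => ?_, ?_, fun U hUT => ?_⟩⟩, ?_⟩
      · have hki : k ≠ i := fun h => hk (h ▸ hiT)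
        simp [hk, hki]
      · simp only [hu T subset_rfl, hiT, subset_refl, if_true, hT]
        ring
      · rw [hu U hUT]
        have h1 := hU U (hUT.trans hTS)
        have h2 := ht U hUT
        by_cases hUT' : U = T
        · subst hUT'
          simp only [hiT, subset_refl, if_true]
          omega
        · have h4 : ¬ T ⊆ U := fun h => hUT' (hUT.antisymm h)
          simp only [h4, if_false]
          have h3 : i ∈ U → ∑ k ∈ U, x k ≠ z U := fun h h' => hUT' (h2 h h')
          split_ifs with hiU
          · have := h3 hiU
            omega
          · omega
      · by_cases hkT : k ∈ T
        · simp [hkT]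
        · simp [hkT, h0 k fun h => hk (Finset.mem_sdiff.2 ⟨h, hkT⟩)]
      · simp only [hv _ subset_rfl, Finset.sdiff_union_of_subset hTS, hS, hT]
      · simp only [hv U hUT]
        have := hU (U ∪ T) (Finset.union_subset (hUT.trans Finset.sdiff_subset) hTS)
        omega
      · funext k
        by_cases hkT : k ∈ T <;> simp [hg, hkT, Pi.single_neg]
  · rintro ⟨u, v⟩ ⟨⟨hu0, -⟩, ⟨hv0, -⟩⟩ ⟨u', v'⟩ ⟨⟨hu0', -⟩, ⟨hv0', -⟩⟩ h
    simp only [hg, add_left_inj] at h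
    dsimp only at hu0 hv0 hu0' hv0'
    have hk := fun k => congrFun h k
    simp only [Pi.add_apply] at hk
    have h1 : u = u' := by
      funext k
      by_cases hkT : k ∈ T
      · have h2 : k ∉ S \ T := fun h => (Finset.mem_sdiff.1 h).2 hkT
        simpa [hv0 k h2, hv0' k h2] using hk k
      · rw [hu0 k hkT, hu0' k hkT]
    subst h1
    simpa using h

/-- The recursion for the numbers of integer points of base polytopes. -/
lemma ncard_basePts_recursion [Fintype α] (hij : i ≠ j) (hi : i ∈ I) (hj : j ∈ I) (hIS : I ⊆ S)
    (hz : SupermodularOn S z) :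
    (basePts S z).ncard = (basePts S fun U => z U - if I ⊆ U then 1 else 0).ncard
      + (basePts (S.erase j) fun U => z (unmerge i j U)).ncard
      + ∑ T ∈ S.powerset with i ∈ T ∧ j ∈ T ∧ ¬ I ⊆ T,
        (basePts T fun U => z U - if T ⊆ U then 1 else 0).ncard
          * (basePts (S \ T) fun U => z (U ∪ T) - z T).ncard := by
  have hfin := finite_basePts S z
  have hcard : ∀ (p : (α → ℤ) → Prop) [DecidablePred p], {x ∈ basePts S z | p x}.ncard
      = ∑ x ∈ hfin.toFinset, if p x then 1 else 0 := by
    intro p _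
    rw [← Finset.card_filter, ← Set.ncard_coe_finset]
    congr 1
    ext x
    simp
  rw [ncard_basePts_sub hi hIS, ncard_basePts_unmerge hij (hIS hi) (hIS hj) hz, hcard, hcard,
    Set.ncard_eq_toFinset_card _ hfin, Finset.card_eq_sum_ones]
  have hQ : ∀ T ∈ S.powerset.filter fun T => i ∈ T ∧ j ∈ T ∧ ¬ I ⊆ T,
      (basePts T fun U => z U - if T ⊆ U then 1 else 0).ncard
          * (basePts (S \ T) fun U => z (U ∪ T) - z T).ncard
        = ∑ x ∈ hfin.toFinset, if ∑ k ∈ T, x k = z T ∧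
            ∀ U ⊆ T, i ∈ U → ∑ k ∈ U, x k = z U → U = T then 1 else 0 := by
    intro T hT
    rw [Finset.mem_filter, Finset.mem_powerset] at hT
    rw [ncard_basePts_prod hT.2.1 hT.1 hz, hcard]
  rw [Finset.sum_congr rfl hQ, Finset.sum_comm, ← Finset.sum_add_distrib,
    ← Finset.sum_add_distrib]
  refine Finset.sum_congr rfl fun x hx => ?_
  rw [Set.Finite.mem_toFinset] at hx
  obtain ⟨T, hTS, hiT, hTt, hleast⟩ := exists_least_tight hz hx (hIS hi)
  have hA : (∀ U ⊆ S, i ∈ U → ∑ k ∈ U, x k = z U → I ⊆ U) ↔ I ⊆ T :=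
    ⟨fun h => h T hTS hiT hTt, fun h U hU hiU hUt => h.trans (hleast U hU hiU hUt)⟩
  have hB : (∃ U ⊆ S, i ∈ U ∧ j ∉ U ∧ ∑ k ∈ U, x k = z U) ↔ j ∉ T :=
    ⟨fun ⟨U, hU, hiU, hjU, hUt⟩ h => hjU (hleast U hU hiU hUt h),
      fun h => ⟨T, hTS, hiT, h, hTt⟩⟩
  have hC : ∀ W ∈ S.powerset.filter fun T => i ∈ T ∧ j ∈ T ∧ ¬ I ⊆ T,
      (∑ k ∈ W, x k = z W ∧ ∀ U ⊆ W, i ∈ U → ∑ k ∈ U, x k = z U → U = W) ↔ T = W := by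
    intro W hW
    rw [Finset.mem_filter, Finset.mem_powerset] at hW
    constructor
    · rintro ⟨h1, h2⟩
      exact h2 T (hleast W hW.1 hW.2.1 h1) hiT hTt
    · rintro rfl
      exact ⟨hTt, fun U hU hiU hUt => hU.antisymm (hleast U (hU.trans hTS) hiU hUt)⟩
  rw [Finset.sum_congr rfl fun W hW => if_congr (hC W hW) rfl rfl, Finset.sum_ite_eq]
  simp only [hA, hB, Finset.mem_filter, Finset.mem_powerset, hTS, hiT, true_and]
  have h1 : I ⊆ T → j ∈ T := fun h => h hj
  split_ifs <;> tauto

end BasePoints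

section Counting

variable {α : Type*} [DecidableEq α]

lemma zetaSum_sub_single (y : Finset α → ℤ) {I : Finset α} (hI : I.Nonempty) (U : Finset α) :
    zetaSum (y - Pi.single I 1) U = zetaSum y U - if I ⊆ U then 1 else 0 := by
  have h := zetaSum_add (y - Pi.single I 1) (Pi.single I 1) U
  rw [sub_add_cancel, zetaSum_single] at h
  rw [h]
  simp [mem_nonemptySubsets, hI]

lemma supermodularOn_zetaSum_of_nonneg (S : Finset α) {y : Finset α → ℤ} (hy : ∀ J, 0 ≤ y J) :
    SupermodularOn S (zetaSum y) :=
  fun A _ B _ => zetaSum_supermodular hy A B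

lemma SupermodularOn.zetaSum_add_single {S : Finset α} {y : Finset α → ℤ}
    (hy : SupermodularOn S (zetaSum y)) (J : Finset α) :
    SupermodularOn S (zetaSum (y + Pi.single J 1)) := by
  intro A hA B hB
  have h1 := hy A hA B hB
  have h2 := zetaSum_supermodular (y := Pi.single J (1 : ℤ))
    (fun K => by rw [Pi.single_apply]; split_ifs <;> simp) A B
  simp only [zetaSum_add]
  omega

lemma basePts_zetaSum_zero (S : Finset α) :
    basePts S (zetaSum (0 : Finset α → ℤ)) = {0} := by
  ext x
  simp only [basePts, zetaSum_zero, Set.mem_ofPred_eq, Set.mem_singleton_iff]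
  constructor
  · rintro ⟨h0, hS, hU⟩
    have hk : ∀ k ∈ S, 0 ≤ x k := fun k hk => by
      simpa using hU {k} (by simpa using hk)
    rw [Finset.sum_eq_zero_iff_of_nonneg hk] at hS
    funext k
    by_cases hkS : k ∈ S
    · exact hS k hkS
    · exact h0 k hkS
  · rintro rfl
    simp

lemma ncard_basePts_sub_single_singleton {S : Finset α} {k : α} (hk : k ∈ S)
    (y : Finset α → ℤ) :
    (basePts S (zetaSum (y - Pi.single {k} 1))).ncard = (basePts S (zetaSum y)).ncard := by
  rw [← Set.ncard_image_of_injective _ (add_left_injective (Pi.single k (1 : ℤ)))]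
  congr 1
  ext x
  simp only [Set.image_add_right, Set.mem_preimage, basePts, Set.mem_ofPred_eq, ← Pi.single_neg,
    sum_add_single, zetaSum_sub_single y (Finset.singleton_nonempty k),
    Finset.singleton_subset_iff, if_pos hk]
  refine and_congr (forall₂_congr fun l hl => ?_) (and_congr (by omega) ?_)
  · have hlk : l ≠ k := fun h => hl (h ▸ hk)
    simp [hlk]
  · refine forall₂_congr fun U _ => ?_
    split_ifs <;> omega

lemma not_draconian_add_single_singleton {S : Finset α} {k : α} (hk : k ∈ S)
    (b : Finset α → ℕ) : ¬ Draconian S (b + Pi.single {k} 1) := by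
  rw [draconian_add_single_iff (Finset.singleton_nonempty k)]
  intro h
  have := h.2 {k} (by simpa using hk) subset_rfl
  simp at this

variable [Fintype α]

lemma SupermodularOn.zetaSum_push_merge {S : Finset α} {y : Finset α → ℤ} {i j : α}
    (hj : j ∈ S) (hy : SupermodularOn S (zetaSum y)) :
    SupermodularOn (S.erase j) (zetaSum (push (merge i j) y)) := by
  intro A hA B hB
  obtain ⟨hAS, hjA⟩ := Finset.subset_erase.1 hA
  obtain ⟨hBS, hjB⟩ := Finset.subset_erase.1 hB
  have hsub : ∀ U ⊆ S, unmerge i j U ⊆ S := by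
    intro U hU
    rw [unmerge]
    split_ifs
    · exact Finset.insert_subset hj hU
    · exact hU
  have h1 := hy _ (hsub A hAS) _ (hsub B hBS)
  have h2 : unmerge i j A ∪ unmerge i j B = unmerge i j (A ∪ B) := by
    ext k
    simp only [unmerge]
    grind
  have h3 : unmerge i j A ∩ unmerge i j B = unmerge i j (A ∩ B) := by
    ext k
    simp only [unmerge]
    grind
  rwa [h2, h3, ← _root_.zetaSum_push_merge y hjA, ← _root_.zetaSum_push_merge y hjB,
    ← _root_.zetaSum_push_merge y (by simp [hjA, hjB] : j ∉ A ∪ B),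
    ← _root_.zetaSum_push_merge y (by simp [hjA] : j ∉ A ∩ B)] at h1

lemma SupermodularOn.zetaSum_push_sdiff {S T : Finset α} {y : Finset α → ℤ} (hTS : T ⊆ S)
    (hy : SupermodularOn S (zetaSum y)) :
    SupermodularOn (S \ T) (zetaSum (push (fun J => J \ T) y)) := by
  intro A hA B hB
  have h := hy (A ∪ T) (Finset.union_subset (hA.trans Finset.sdiff_subset) hTS)
    (B ∪ T) (Finset.union_subset (hB.trans Finset.sdiff_subset) hTS)
  rw [← Finset.union_union_distrib_right, ← Finset.inter_union_distrib_right] at h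
  simp only [← _root_.zetaSum_push_sdiff y T] at h
  omega

/-- The hypothesis for the induction on the ground set: both counting formulas hold on `T`. -/
def CountsOn (T : Finset α) : Prop :=
  ∀ y : Finset α → ℤ, SupermodularOn T (zetaSum y) →
    ((basePts T (zetaSum y)).ncard : ℝ) = draconianSum T y ∧
    ((basePts T (zetaSum (y - Pi.single T 1))).ncard : ℝ) = fullDraconianSum T y

lemma ncard_basePts_sub_draconianSum_of_two {S J : Finset α} {i j : α} (hij : i ≠ j)
    (hi : i ∈ J) (hj : j ∈ J) (hJS : J ⊆ S) (ih : ∀ T ⊂ S, T.Nonempty → CountsOn T)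
    {y : Finset α → ℤ} (hy : SupermodularOn S (zetaSum y)) :
    ((basePts S (zetaSum y)).ncard : ℝ) - draconianSum S y
      = (basePts S (zetaSum (y - Pi.single J 1))).ncard - draconianSum S (y - Pi.single J 1) := by
  have h1 : basePts S (zetaSum (y - Pi.single J 1))
      = basePts S fun U => zetaSum y U - if J ⊆ U then 1 else 0 :=
    basePts_congr fun U _ => zetaSum_sub_single y ⟨i, hi⟩ U
  have h2 : ((basePts (S.erase j) fun U => zetaSum y (unmerge i j U)).ncard : ℝ)
      = draconianSum (S.erase j) (push (merge i j) y) := by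
    rw [← (ih (S.erase j) (Finset.erase_ssubset (hJS hj)) ⟨i, by simp [hij, hJS hi]⟩ _
      (hy.zetaSum_push_merge (hJS hj))).1]
    congr 2
    exact basePts_congr fun U hU =>
      (zetaSum_push_merge y fun h => Finset.notMem_erase j S (hU h)).symm
  have h3 : ∀ T ∈ S.powerset.filter fun T => i ∈ T ∧ j ∈ T ∧ ¬ J ⊆ T,
      (((basePts T fun U => zetaSum y U - if T ⊆ U then 1 else 0).ncard
        * (basePts (S \ T) fun U => zetaSum y (U ∪ T) - zetaSum y T).ncard : ℕ) : ℝ)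
      = fullDraconianSum T y * draconianSum (S \ T) (push (fun J => J \ T) y) := by
    intro T hT
    rw [Finset.mem_filter, Finset.mem_powerset] at hT
    obtain ⟨hTS, hiT, -, hJT⟩ := hT
    have hne : ¬ S ⊆ T := fun h => hJT (hJS.trans h)
    rw [← (ih T ⟨hTS, hne⟩ ⟨i, hiT⟩ y (hy.mono hTS)).2,
      ← (ih (S \ T) (Finset.sdiff_ssubset hTS ⟨i, hiT⟩) (Finset.sdiff_nonempty.2 hne) _
        (hy.zetaSum_push_sdiff hTS)).1, Nat.cast_mul]
    congr 3
    · exact basePts_congr fun U _ => (zetaSum_sub_single y ⟨i, hiT⟩ U).symm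
    · exact basePts_congr fun U _ => (eq_sub_of_add_eq (zetaSum_push_sdiff y T U)).symm
  have hN := ncard_basePts_recursion hij hi hj hJS hy
  have hD := draconianSum_sub_single hij hi hj hJS y
  rw [← Finset.sum_congr rfl h3, ← h2] at hD
  rw [h1, hN]
  push_cast at hD ⊢
  linarith

lemma ncard_basePts_sub_draconianSum {S : Finset α} (ih : ∀ T ⊂ S, T.Nonempty → CountsOn T)
    (J : Finset α) {y : Finset α → ℤ} (hy : SupermodularOn S (zetaSum y)) :
    ((basePts S (zetaSum y)).ncard : ℝ) - draconianSum S y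
      = (basePts S (zetaSum (y - Pi.single J 1))).ncard - draconianSum S (y - Pi.single J 1) := by
  by_cases hJ : J ∈ nonemptySubsets S
  swap
  · have h1 : draconianSum S (y - Pi.single J 1) = draconianSum S y :=
      multiCSum_sub_single_of_notMem _ y hJ
    have h2 : basePts S (zetaSum (y - Pi.single J 1)) = basePts S (zetaSum y) := by
      refine basePts_congr fun U hU => Finset.sum_congr rfl fun K hK => ?_
      have hKJ : K ≠ J := by
        rintro rfl
        rw [mem_nonemptySubsets] at hJ hK
        exact hJ ⟨hK.1, hK.2.trans hU⟩
      simp [hKJ]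
    rw [h1, h2]
  obtain ⟨⟨i, hi⟩, hJS⟩ := mem_nonemptySubsets.1 hJ
  by_cases hcard : ∃ j ∈ J, i ≠ j
  · obtain ⟨j, hj, hij⟩ := hcard
    exact ncard_basePts_sub_draconianSum_of_two hij hi hj hJS ih hy
  · have hJi : J = {i} := by
      refine Finset.eq_singleton_iff_unique_mem.2 ⟨hi, fun k hk => ?_⟩
      by_contra h
      exact hcard ⟨k, hk, fun h' => h h'.symm⟩
    subst hJi
    rw [ncard_basePts_sub_single_singleton (hJS hi),
      draconianSum_sub_single_eq_of_not_draconian (not_draconian_add_single_singleton (hJS hi))]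

lemma ncard_basePts_eq_draconianSum {S : Finset α} (hS : S.Nonempty)
    (ih : ∀ T ⊂ S, T.Nonempty → CountsOn T) (y : Finset α → ℤ)
    (hy : SupermodularOn S (zetaSum y)) :
    ((basePts S (zetaSum y)).ncard : ℝ) = draconianSum S y := by
  have : Nonempty α := ⟨hS.choose⟩
  induction y using int_vector_induction with
  | zero =>
    rw [basePts_zetaSum_zero, Set.ncard_singleton, draconianSum,
      multiCSum_zero_right Fintype.card_pos, draconianInd, if_pos, Nat.cast_one]
    intro U _ hU
    simpa using hU.card_pos
  | neg y J _ h =>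
    have h1 := hy.zetaSum_add_single J
    have h2 := ncard_basePts_sub_draconianSum ih J h1
    rw [h h1, add_sub_cancel_right] at h2
    linarith
  | pos y J hpos hJ h =>
    have h1 : SupermodularOn S (zetaSum (y - Pi.single J 1)) := by
      refine supermodularOn_zetaSum_of_nonneg S fun K => ?_
      have := hpos K
      rw [Pi.sub_apply, Pi.single_apply]
      split_ifs with hK
      · rw [hK]
        omega
      · omega
    have h2 := ncard_basePts_sub_draconianSum ih J hy
    rw [h h1] at h2
    linarith

/-- Integer points of base polytopes are counted by draconian sums. -/
theorem countsOn {S : Finset α} (hS : S.Nonempty) : CountsOn S := by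
  induction S using Finset.strongInduction with
  | H S ih =>
    have : Nonempty α := ⟨hS.choose⟩
    intro y hy
    have h1 := ncard_basePts_eq_draconianSum hS ih
    refine ⟨h1 y hy, ?_⟩
    rw [fullDraconianSum_eq hS]
    by_cases hcard : #S ≤ 1
    · refine h1 _ fun A hA B hB => ?_
      obtain ⟨k, rfl⟩ := Finset.card_eq_one.1 (le_antisymm hcard hS.card_pos)
      rcases Finset.subset_singleton_iff.1 hA with rfl | rfl <;>
        rcases Finset.subset_singleton_iff.1 hB with rfl | rfl <;> simp
    · have h2 := ncard_basePts_sub_draconianSum ih S hy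
      rw [h1 y hy] at h2
      linarith

end Counting

section LocalSupermodularity

variable {α : Type*} [DecidableEq α]

lemma supermodularOn_of_local {z : Finset α → ℤ}
    (h : ∀ (A : Finset α) (i k : α), i ∉ A → k ∉ A → i ≠ k →
      z (insert i A) + z (insert k A) ≤ z (insert i (insert k A)) + z A) (S : Finset α) :
    SupermodularOn S z := by
  have h1 : ∀ (A C : Finset α) (i : α), i ∉ A → i ∉ C →
      z (insert i A) + z (A ∪ C) ≤ z (insert i (A ∪ C)) + z A := by
    intro A C i hiA
    induction C using Finset.induction with
    | empty => simp [add_comm]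
    | insert k C hkC ih =>
      intro hiC
      rw [Finset.mem_insert, not_or] at hiC
      have h2 := ih hiC.2
      rw [Finset.union_insert]
      by_cases hk : k ∈ A ∪ C
      · rwa [Finset.insert_eq_of_mem hk]
      · have h3 := h (A ∪ C) i k (by simp [hiA, hiC.2]) hk hiC.1
        omega
  have h2 : ∀ A B C : Finset α, A ⊆ B → Disjoint C B →
      z (A ∪ C) + z B ≤ z (B ∪ C) + z A := by
    intro A B C hAB
    induction C using Finset.induction with
    | empty => simp [add_comm]
    | insert i C hiC ih =>
      intro hdis
      rw [Finset.disjoint_insert_left] at hdis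
      have h3 := ih hdis.2
      have h4 := h1 (A ∪ C) B i (by grind) hdis.1
      rw [Finset.union_right_comm, Finset.union_eq_right.2 hAB] at h4
      rw [Finset.union_insert, Finset.union_insert]
      omega
  intro A _ B _
  have h3 := h2 (A ∩ B) B (A \ B) Finset.inter_subset_right Finset.sdiff_disjoint
  rw [Finset.union_comm (A ∩ B), Finset.sdiff_union_inter, Finset.union_sdiff_self_eq_union,
    Finset.union_comm B A] at h3
  exact h3

variable [Fintype α]

lemma zetaSum_insert_insert {M : Type*} [AddCommMonoid M] (y : Finset α → M) {A : Finset α}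
    {i k : α} (hi : i ∉ A) (hk : k ∉ A) (hik : i ≠ k) :
    zetaSum y (insert i (insert k A)) + zetaSum y A
      = zetaSum y (insert i A) + zetaSum y (insert k A)
        + ∑ I with {i, k} ⊆ I ∧ I ⊆ insert i (insert k A), y I := by
  have h1 : nonemptySubsets (insert i A) ∩ nonemptySubsets (insert k A) = nonemptySubsets A := by
    ext J
    simp only [Finset.mem_inter, mem_nonemptySubsets, Finset.subset_iff, Finset.mem_insert]
    grind
  have h2 : Disjoint (nonemptySubsets (insert i A) ∪ nonemptySubsets (insert k A))
      (Finset.univ.filter fun I => {i, k} ⊆ I ∧ I ⊆ insert i (insert k A)) := by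
    rw [Finset.disjoint_left]
    intro J hJ hJ'
    simp only [Finset.mem_union, mem_nonemptySubsets, Finset.subset_iff, Finset.mem_insert,
      Finset.mem_filter, Finset.mem_univ, true_and, Finset.mem_singleton] at hJ hJ'
    grind
  have h3 : nonemptySubsets (insert i (insert k A))
      = (nonemptySubsets (insert i A) ∪ nonemptySubsets (insert k A)) ∪
        Finset.univ.filter fun I => {i, k} ⊆ I ∧ I ⊆ insert i (insert k A) := by
    ext J
    obtain rfl | hJ := J.eq_empty_or_nonempty
    · simp [mem_nonemptySubsets, Finset.insert_subset_iff]
    · simp only [Finset.mem_union, mem_nonemptySubsets, hJ, Finset.subset_iff, Finset.mem_insert,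
        Finset.mem_filter, Finset.mem_univ, true_and, Finset.mem_singleton]
      grind
  rw [zetaSum, h3, Finset.sum_union h2, zetaSum, ← h1, add_right_comm, Finset.sum_union_inter]
  rfl

lemma supermodularOn_zetaSum_of_local {y : Finset α → ℤ}
    (hy : ∀ E T : Finset α, #E = 2 → E ⊆ T → 0 ≤ ∑ I with E ⊆ I ∧ I ⊆ T, y I) (S : Finset α) :
    SupermodularOn S (zetaSum y) := by
  refine supermodularOn_of_local (fun A i k hi hk hik => ?_) S
  have h1 := hy {i, k} (insert i (insert k A)) (Finset.card_pair hik)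
    (by simp [Finset.insert_subset_iff])
  have h2 := zetaSum_insert_insert y hi hk hik
  omega

end LocalSupermodularity

section SupportFunction

variable {d : ℕ}

/-- The minimum of `c` over `I`. -/
noncomputable def minOver {ι : Type*} (c : ι → ℝ) (I : Finset ι) : ℝ :=
  if h : I.Nonempty then I.inf' h c else 0

lemma minOver_eq {ι : Type*} {c : ι → ℝ} {I : Finset ι} {k : ι} (hk : k ∈ I)
    (h : ∀ l ∈ I, c k ≤ c l) : minOver c I = c k := by
  rw [minOver, dif_pos ⟨k, hk⟩]
  exact le_antisymm (Finset.inf'_le _ hk) (Finset.le_inf' _ _ h)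

lemma exists_eq_minOver {ι : Type*} (c : ι → ℝ) {I : Finset ι} (hI : I.Nonempty) :
    ∃ k ∈ I, minOver c I = c k ∧ ∀ l ∈ I, c k ≤ c l := by
  obtain ⟨k, hk, h⟩ := I.exists_min_image c hI
  exact ⟨k, hk, minOver_eq hk h, h⟩

lemma minOver_add_indicator {ι : Type*} [DecidableEq ι] {c : ι → ℝ} {T : Finset ι} {δ : ℝ}
    (hδ : 0 ≤ δ) (hc : ∀ k ∈ T, ∀ l ∉ T, c l ≤ c k) {I : Finset ι} (hI : I.Nonempty) :
    minOver (fun k => c k + if k ∈ T then δ else 0) I = minOver c I + if I ⊆ T then δ else 0 := by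
  split_ifs with hIT
  · obtain ⟨k, hk, hmin, hle⟩ := exists_eq_minOver c hI
    rw [hmin, minOver_eq hk, if_pos (hIT hk)]
    intro l hl
    rw [if_pos (hIT hk), if_pos (hIT hl)]
    linarith [hle l hl]
  · obtain ⟨k, hk, hmin⟩ := (I \ T).exists_min_image c (Finset.sdiff_nonempty.2 hIT)
    obtain ⟨hkI, hkT⟩ := Finset.mem_sdiff.1 hk
    have hle : ∀ l ∈ I, c k ≤ c l := by
      intro l hl
      by_cases hlT : l ∈ T
      · exact hc l hlT k hkT
      · exact hmin l (Finset.mem_sdiff.2 ⟨hl, hlT⟩)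
    rw [minOver_eq hkI hle, minOver_eq hkI, if_neg hkT]
    intro l hl
    rw [if_neg hkT]
    split_ifs <;> linarith [hle l hl]

/-- The Lovász extension of `zetaSum y`. -/
noncomputable def lovasz {ι : Type*} [DecidableEq ι] [Fintype ι] (y : Finset ι → ℤ)
    (c : ι → ℝ) : ℝ :=
  ∑ I ∈ nonemptySubsets Finset.univ, y I * minOver c I

section Lovasz

variable {ι : Type*} [DecidableEq ι] [Fintype ι]

lemma cast_zetaSum (y : Finset ι → ℤ) (T : Finset ι) :
    ((zetaSum y T : ℤ) : ℝ)
      = ∑ I ∈ nonemptySubsets Finset.univ, (y I : ℝ) * if I ⊆ T then 1 else 0 := by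
  rw [zetaSum, Int.cast_sum]
  simp only [mul_ite, mul_one, mul_zero]
  rw [← Finset.sum_filter]
  refine Finset.sum_congr ?_ fun _ _ => rfl
  ext I
  simp [mem_nonemptySubsets]

lemma lovasz_const (y : Finset ι → ℤ) (t : ℝ) :
    lovasz y (fun _ => t) = t * zetaSum y Finset.univ := by
  rw [cast_zetaSum, lovasz, Finset.mul_sum]
  refine Finset.sum_congr rfl fun I hI => ?_
  obtain ⟨k, hk⟩ := (mem_nonemptySubsets.1 hI).1
  rw [minOver_eq hk fun _ _ => le_rfl, if_pos (Finset.subset_univ I)]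
  ring

lemma lovasz_add_indicator (y : Finset ι → ℤ) {c : ι → ℝ} {T : Finset ι} {δ : ℝ}
    (hδ : 0 ≤ δ) (hc : ∀ k ∈ T, ∀ l ∉ T, c l ≤ c k) :
    lovasz y (fun k => c k + if k ∈ T then δ else 0) = lovasz y c + δ * zetaSum y T := by
  rw [cast_zetaSum, lovasz, lovasz, Finset.mul_sum, ← Finset.sum_add_distrib]
  refine Finset.sum_congr rfl fun I hI => ?_
  rw [minOver_add_indicator hδ hc (mem_nonemptySubsets.1 hI).1]
  split_ifs <;> ring

lemma lovasz_indicator (y : Finset ι → ℤ) (T : Finset ι) :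
    lovasz y (fun k => if k ∈ T then 1 else 0) = zetaSum y T := by
  have h := lovasz_add_indicator y (c := fun _ => 0) (T := T) zero_le_one fun _ _ _ _ => le_rfl
  simpa [lovasz_const] using h

lemma lovasz_le_dot {y : Finset ι → ℤ} {x : ι → ℝ} (huniv : ∑ k, x k = zetaSum y Finset.univ)
    (hx : ∀ T : Finset ι, ((zetaSum y T : ℤ) : ℝ) ≤ ∑ k ∈ T, x k) (c : ι → ℝ) :
    lovasz y c ≤ ∑ k, c k * x k := by
  induction h : #(Finset.univ.image c) using Nat.strong_induction_on generalizing c with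
  | _ m ih =>
  subst h
  by_cases hconst : ∃ t, c = fun _ => t
  · obtain ⟨t, rfl⟩ := hconst
    rw [lovasz_const, ← Finset.mul_sum, huniv]
  have hne : (Finset.univ : Finset ι).Nonempty := by
    by_contra h
    rw [Finset.univ_nonempty_iff, not_nonempty_iff] at h
    exact hconst ⟨0, Subsingleton.elim _ _⟩
  obtain ⟨i, -, hi⟩ := Finset.univ.exists_max_image c hne
  set T : Finset ι := Finset.univ.filter fun k => c k = c i with hT
  have hTc : (Finset.univ \ T).Nonempty := by
    rw [Finset.sdiff_nonempty]
    intro h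
    refine hconst ⟨c i, funext fun k => ?_⟩
    simpa [hT] using h (Finset.mem_univ k)
  obtain ⟨j, hj, hjmax⟩ := (Finset.univ \ T).exists_max_image c hTc
  simp only [hT, Finset.mem_sdiff, Finset.mem_univ, Finset.mem_filter, true_and] at hj hjmax
  have hji : c j < c i := lt_of_le_of_ne (hi j (Finset.mem_univ j)) hj
  set c' : ι → ℝ := fun k => if c k = c i then c j else c k with hc'
  have hcc' : c = fun k => c' k + if k ∈ T then c i - c j else 0 := by
    funext k
    by_cases hk : c k = c i <;> simp [hc', hT, hk]
  have hle : ∀ k ∈ T, ∀ l ∉ T, c' l ≤ c' k := by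
    intro k hk l hl
    simp only [hT, Finset.mem_filter, Finset.mem_univ, true_and] at hk hl
    simp only [hc', if_pos hk, if_neg hl]
    exact hjmax l hl
  have hcard : #(Finset.univ.image c') < #(Finset.univ.image c) := by
    refine Finset.card_lt_card ⟨fun t ht => ?_, fun h => ?_⟩
    · obtain ⟨k, -, rfl⟩ := Finset.mem_image.1 ht
      simp only [hc']
      split_ifs
      · exact Finset.mem_image_of_mem c (Finset.mem_univ j)
      · exact Finset.mem_image_of_mem c (Finset.mem_univ k)
    · obtain ⟨k, -, hk⟩ := Finset.mem_image.1 (h (Finset.mem_image_of_mem c (Finset.mem_univ i)))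
      simp only [hc'] at hk
      split_ifs at hk with hk'
      · exact hj hk
      · exact hk' hk
  have h1 := ih _ hcard c' rfl
  have h2 := lovasz_add_indicator y (sub_nonneg.2 hji.le) hle
  rw [← hcc'] at h2
  have h3 : ∑ k, c k * x k = ∑ k, c' k * x k + (c i - c j) * ∑ k ∈ T, x k := by
    conv_lhs => rw [hcc']
    simp only [add_mul, ite_mul, zero_mul, Finset.sum_add_distrib, Finset.mul_sum]
    rw [Finset.sum_ite_mem, Finset.univ_inter]
  have h4 := mul_le_mul_of_nonneg_left (hx T) (sub_nonneg.2 hji.le)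
  linarith

end Lovasz

lemma minOver_le_of_mem_stdSimp (c : Fin d → ℝ) {I : Finset (Fin d)} (hI : I.Nonempty)
    {x : Fin d → ℝ} (hx : x ∈ stdSimp d I) : minOver c I ≤ ∑ k, c k * x k := by
  have hlin : IsLinearMap ℝ fun x : Fin d → ℝ => ∑ k, c k * x k :=
    ⟨fun x y => by simp [mul_add, Finset.sum_add_distrib],
      fun a x => by simp [Finset.mul_sum, mul_left_comm]⟩
  refine convexHull_min (fun p hp => ?_) (convex_halfSpace_ge hlin (minOver c I)) hx
  obtain ⟨k, hk, rfl⟩ := hp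
  obtain ⟨l, -, hmin, hle⟩ := exists_eq_minOver c hI
  simpa [hmin, Pi.single_apply] using hle k hk

lemma exists_mem_stdSimp (c : Fin d → ℝ) {I : Finset (Fin d)} (hI : I.Nonempty) :
    ∃ x ∈ stdSimp d I, ∑ k, c k * x k = minOver c I := by
  obtain ⟨l, hl, hmin, -⟩ := exists_eq_minOver c hI
  exact ⟨Pi.single l 1, subset_convexHull ℝ _ ⟨l, hl, rfl⟩, by simp [hmin, Pi.single_apply]⟩

lemma sum_mul_minOver_le_of_mem (c : Fin d → ℝ) {s : Finset (Finset (Fin d))}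
    (hs : ∀ I ∈ s, I.Nonempty) {a : Finset (Fin d) → ℝ} (ha : ∀ I ∈ s, 0 ≤ a I) {x : Fin d → ℝ}
    (hx : x ∈ ∑ I ∈ s, a I • stdSimp d I) : ∑ I ∈ s, a I * minOver c I ≤ ∑ k, c k * x k := by
  obtain ⟨g, hg, rfl⟩ := (Set.mem_finsetSum _ _ _).1 hx
  simp only [Finset.sum_apply, Finset.mul_sum]
  rw [Finset.sum_comm]
  refine Finset.sum_le_sum fun I hI => ?_
  obtain ⟨p, hp, hgp⟩ := Set.mem_smul_set.1 (hg hI)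
  have h := mul_le_mul_of_nonneg_left (minOver_le_of_mem_stdSimp c (hs I hI) hp) (ha I hI)
  rw [Finset.mul_sum] at h
  refine h.trans_eq (Finset.sum_congr rfl fun k _ => ?_)
  rw [← hgp, Pi.smul_apply, smul_eq_mul]
  ring

lemma exists_mem_sum_smul_stdSimp (c : Fin d → ℝ) {s : Finset (Finset (Fin d))}
    (hs : ∀ I ∈ s, I.Nonempty) (a : Finset (Fin d) → ℝ) :
    ∃ x ∈ ∑ I ∈ s, a I • stdSimp d I, ∑ k, c k * x k = ∑ I ∈ s, a I * minOver c I := by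
  have h : ∀ I : Finset (Fin d), ∃ x, I ∈ s → x ∈ stdSimp d I ∧ ∑ k, c k * x k = minOver c I := by
    intro I
    by_cases hI : I ∈ s
    · obtain ⟨x, hx⟩ := exists_mem_stdSimp c (hs I hI)
      exact ⟨x, fun _ => hx⟩
    · exact ⟨0, fun h => absurd h hI⟩
  choose g hg using h
  refine ⟨∑ I ∈ s, a I • g I, (Set.mem_finsetSum _ _ _).2 ⟨fun I => a I • g I,
    fun {I} hI => Set.smul_mem_smul_set (hg I hI).1, rfl⟩, ?_⟩
  simp only [Finset.sum_apply, Finset.mul_sum, Pi.smul_apply, smul_eq_mul]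
  rw [Finset.sum_comm]
  refine Finset.sum_congr rfl fun I hI => ?_
  rw [← (hg I hI).2, Finset.mul_sum]
  exact Finset.sum_congr rfl fun k _ => by ring

end SupportFunction

section Polytope

variable {d : ℕ} {y : Finset (Fin d) → ℤ} {P : Set (Fin d → ℝ)}

lemma lovasz_add_neg_sum (y : Finset (Fin d) → ℤ) (c : Fin d → ℝ) :
    lovasz y c + ∑ I with I.Nonempty ∧ y I < 0, ((-(y I) : ℤ) : ℝ) * minOver c I
      = ∑ I with I.Nonempty ∧ 0 ≤ y I, ((y I : ℤ) : ℝ) * minOver c I := by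
  have h : nonemptySubsets Finset.univ
      = (Finset.univ.filter fun I : Finset (Fin d) => I.Nonempty ∧ 0 ≤ y I) ∪
        Finset.univ.filter fun I : Finset (Fin d) => I.Nonempty ∧ y I < 0 := by
    ext I
    simp only [mem_nonemptySubsets, Finset.subset_univ, and_true, Finset.mem_union,
      Finset.mem_filter, Finset.mem_univ, true_and, ← and_or_left, le_or_gt]
  rw [lovasz, h, Finset.sum_union, add_assoc, ← Finset.sum_add_distrib]
  · simp
  · rw [Finset.disjoint_left]
    intro I hI hI'
    simp only [Finset.mem_filter] at hI hI'
    exact hI.2.2.not_gt hI'.2.2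

lemma lovasz_le_dot_of_mem
    (hPsum : P + (∑ I with I.Nonempty ∧ y I < 0, ((-(y I) : ℤ) : ℝ) • stdSimp d I)
      = ∑ I with I.Nonempty ∧ 0 ≤ y I, ((y I : ℤ) : ℝ) • stdSimp d I)
    (c : Fin d → ℝ) {p : Fin d → ℝ} (hp : p ∈ P) : lovasz y c ≤ ∑ k, c k * p k := by
  obtain ⟨q, hq, hqc⟩ := exists_mem_sum_smul_stdSimp c
    (s := Finset.univ.filter fun I : Finset (Fin d) => I.Nonempty ∧ y I < 0)
    (fun I hI => (Finset.mem_filter.1 hI).2.1) fun I => ((-(y I) : ℤ) : ℝ)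
  have h1 := Set.add_mem_add hp hq
  rw [hPsum] at h1
  have h2 := sum_mul_minOver_le_of_mem c (fun I hI => (Finset.mem_filter.1 hI).2.1)
    (fun I hI => by exact_mod_cast (Finset.mem_filter.1 hI).2.2) h1
  have h3 := lovasz_add_neg_sum y c
  simp only [Pi.add_apply, mul_add, Finset.sum_add_distrib] at h2
  linarith

lemma exists_mem_dot_le_lovasz
    (hPsum : P + (∑ I with I.Nonempty ∧ y I < 0, ((-(y I) : ℤ) : ℝ) • stdSimp d I)
      = ∑ I with I.Nonempty ∧ 0 ≤ y I, ((y I : ℤ) : ℝ) • stdSimp d I)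
    (c : Fin d → ℝ) : ∃ p ∈ P, ∑ k, c k * p k ≤ lovasz y c := by
  obtain ⟨b, hb, hbc⟩ := exists_mem_sum_smul_stdSimp c
    (s := Finset.univ.filter fun I : Finset (Fin d) => I.Nonempty ∧ 0 ≤ y I)
    (fun I hI => (Finset.mem_filter.1 hI).2.1) fun I => ((y I : ℤ) : ℝ)
  rw [← hPsum] at hb
  obtain ⟨p, hp, q, hq, rfl⟩ := Set.mem_add.1 hb
  refine ⟨p, hp, ?_⟩
  have h2 := sum_mul_minOver_le_of_mem c (fun I hI => (Finset.mem_filter.1 hI).2.1)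
    (fun I hI => by exact_mod_cast (neg_pos.2 (Finset.mem_filter.1 hI).2.2).le) hq
  have h3 := lovasz_add_neg_sum y c
  simp only [Pi.add_apply, mul_add, Finset.sum_add_distrib] at hbc
  linarith

lemma mem_iff_of_add_eq (hP : IsPolytope P)
    (hPsum : P + (∑ I with I.Nonempty ∧ y I < 0, ((-(y I) : ℤ) : ℝ) • stdSimp d I)
      = ∑ I with I.Nonempty ∧ 0 ≤ y I, ((y I : ℤ) : ℝ) • stdSimp d I) (x : Fin d → ℝ) :
    x ∈ P ↔ ∑ k, x k = zetaSum y Finset.univ ∧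
      ∀ T : Finset (Fin d), ((zetaSum y T : ℤ) : ℝ) ≤ ∑ k ∈ T, x k := by
  constructor
  · intro hx
    have h : ∀ T : Finset (Fin d), ((zetaSum y T : ℤ) : ℝ) ≤ ∑ k ∈ T, x k := by
      intro T
      have h1 := lovasz_le_dot_of_mem hPsum (fun k => if k ∈ T then 1 else 0) hx
      rw [lovasz_indicator] at h1
      simpa using h1
    refine ⟨le_antisymm ?_ (h _), h⟩
    have h1 := lovasz_le_dot_of_mem hPsum (fun _ => -1) hx
    rw [lovasz_const, ← Finset.mul_sum] at h1
    linarith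
  · rintro ⟨huniv, hT⟩
    obtain ⟨S, rfl⟩ := hP
    by_contra hx
    obtain ⟨f, u, hfx, hfu⟩ := geometric_hahn_banach_point_closed (convex_convexHull ℝ _)
      (S.finite_toSet.isCompact_convexHull ℝ).isClosed hx
    have hf : ∀ v, f v = ∑ k, f (Pi.single k 1) * v k := by
      intro v
      have h := LinearMap.pi_apply_eq_sum_univ (f : (Fin d → ℝ) →ₗ[ℝ] ℝ) v
      simp only [ContinuousLinearMap.coe_coe, smul_eq_mul] at h
      rw [h]
      refine Finset.sum_congr rfl fun k _ => ?_
      rw [mul_comm]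
      congr 2
      ext l
      simp [Pi.single_apply, eq_comm]
    obtain ⟨p, hp, hpc⟩ := exists_mem_dot_le_lovasz hPsum fun k => f (Pi.single k 1)
    have h1 := lovasz_le_dot huniv hT fun k => f (Pi.single k 1)
    have h2 := hfu p hp
    rw [hf] at h2 hfx
    linarith

lemma ncard_inter_latticePts (hP : IsPolytope P)
    (hPsum : P + (∑ I with I.Nonempty ∧ y I < 0, ((-(y I) : ℤ) : ℝ) • stdSimp d I)
      = ∑ I with I.Nonempty ∧ 0 ≤ y I, ((y I : ℤ) : ℝ) • stdSimp d I) :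
    (P ∩ latticePts d).ncard = (basePts Finset.univ (zetaSum y)).ncard := by
  have hinj : Function.Injective fun (x : Fin d → ℤ) (k : Fin d) => (x k : ℝ) :=
    fun x x' h => funext fun k => Int.cast_injective (congrFun h k)
  rw [← Set.ncard_image_of_injective _ hinj]
  congr 1
  ext x
  simp only [Set.mem_inter_iff, mem_iff_of_add_eq hP hPsum, Set.mem_image, basePts,
    Set.mem_ofPred_eq, latticePts]
  constructor
  · rintro ⟨⟨h1, h2⟩, h3⟩
    choose m hm using h3
    simp only [hm] at h1 h2
    exact ⟨m, ⟨by simp, by exact_mod_cast h1, fun U _ => by exact_mod_cast h2 U⟩, (funext hm).symm⟩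
  · rintro ⟨m, ⟨-, h1, h2⟩, rfl⟩
    refine ⟨⟨?_, fun T => ?_⟩, fun k => ⟨m k, rfl⟩⟩
    · dsimp only
      exact_mod_cast h1
    · dsimp only
      exact_mod_cast h2 T (Finset.subset_univ T)

end Polytope

section DragonMarriage

variable {α : Type*} [DecidableEq α] [Fintype α]

lemma fullDraconian_univ_iff [Nonempty α] (b : Finset α → ℕ) :
    FullDraconian Finset.univ b ↔ ∑ I with I.Nonempty, b I = Fintype.card α - 1 ∧
      ∀ M : Finset (Finset α), M.Nonempty → (∀ J ∈ M, J.Nonempty) →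
        1 + ∑ J ∈ M, b J ≤ #(M.sup id) := by
  have h1 : (Finset.univ.filter fun I : Finset α => I.Nonempty) = nonemptySubsets Finset.univ := by
    ext I
    simp [mem_nonemptySubsets]
  have hpos : 0 < Fintype.card α := Fintype.card_pos
  rw [FullDraconian, and_comm, h1, Finset.card_univ, ← zetaSum]
  refine and_congr (by omega) ⟨fun h M hM hMne => ?_, fun h U _ hU => ?_⟩
  · obtain ⟨J, hJ⟩ := hM
    have h2 := h (M.sup id) (Finset.subset_univ _) ((hMne J hJ).mono (Finset.le_sup (f := id) hJ))
    have h3 : ∑ J ∈ M, b J ≤ zetaSum b (M.sup id) :=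
      Finset.sum_le_sum_of_subset fun J hJ =>
        mem_nonemptySubsets.2 ⟨hMne J hJ, Finset.le_sup (f := id) hJ⟩
    omega
  · have h2 := h (nonemptySubsets U) ⟨U, mem_nonemptySubsets.2 ⟨hU, subset_rfl⟩⟩
      fun J hJ => (mem_nonemptySubsets.1 hJ).1
    have h3 : (nonemptySubsets U).sup id ≤ U :=
      Finset.sup_le fun J hJ => (mem_nonemptySubsets.1 hJ).2
    have h4 := Finset.card_le_card h3
    rw [← zetaSum] at h2
    omega

lemma prod_multiC_add_single_univ [Nonempty α] (y : Finset α → ℤ) {b : Finset α → ℕ}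
    (hb : b ∅ = 0) :
    ∏ I, multiC ((y + Pi.single Finset.univ 1 : Finset α → ℤ) I) (b I)
      = genC (y Finset.univ + b Finset.univ) (b Finset.univ) *
        ∏ I with I.Nonempty ∧ I ≠ Finset.univ, genC (y I + b I - 1) (b I) := by
  rw [← Finset.mul_prod_erase _ _ (Finset.mem_univ Finset.univ)]
  congr 1
  · rw [multiC, Pi.add_apply, Pi.single_eq_same]
    congr 1
    ring
  · symm
    refine Finset.prod_subset_one_on_sdiff (fun I hI => ?_) (fun I hI => ?_) fun I hI => ?_
    · simpa using (Finset.mem_filter.1 hI).2.2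
    · obtain rfl : I = ∅ := by
        rw [← Finset.not_nonempty_iff_eq_empty]
        intro hne
        simp_all
      rw [hb, multiC_zero]
    · rw [multiC, Pi.add_apply, Pi.single_eq_of_ne (Finset.mem_filter.1 hI).2.2, add_zero]

end DragonMarriage

lemma fullDraconianSum_univ_add_single {d : ℕ} (hd : 1 ≤ d) (y : Finset (Fin d) → ℤ) :
    fullDraconianSum Finset.univ (y + Pi.single Finset.univ 1)
      = ∑ a : Finset (Fin d) → Fin d with (a ∅ : ℕ) = 0 ∧
            ∑ I with I.Nonempty, (a I : ℕ) = d - 1 ∧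
            ∀ M : Finset (Finset (Fin d)), M.Nonempty → (∀ J ∈ M, J.Nonempty) →
              1 + ∑ J ∈ M, (a J : ℕ) ≤ #(M.sup id),
          genC (y Finset.univ + (a Finset.univ : ℕ)) (a Finset.univ : ℕ) *
            ∏ I with I.Nonempty ∧ I ≠ Finset.univ,
              genC (y I + (a I : ℕ) - 1) (a I : ℕ) := by
  have : Nonempty (Fin d) := ⟨⟨0, hd⟩⟩
  rw [fullDraconianSum, multiCSum]
  simp only [fullDraconianInd, ite_mul, one_mul, zero_mul]
  rw [← Finset.sum_filter]
  symm
  have hmem : ∀ b : Finset (Fin d) → ℕ,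
      (∀ J ∉ nonemptySubsets (Finset.univ : Finset (Fin d)), b J = 0) ↔ b ∅ = 0 := by
    intro b
    simp [mem_nonemptySubsets]
  refine Finset.sum_nbij (fun a I => (a I : ℕ)) (fun a ha => ?_) (fun a _ a' _ h => ?_)
    (fun b hb => ?_) fun a ha => ?_
  · simp only [Finset.mem_filter, Finset.mem_univ, true_and] at ha
    simp only [Finset.mem_filter, Fintype.mem_piFinset, Finset.mem_range, Fintype.card_fin, hmem,
      fullDraconian_univ_iff]
    exact ⟨⟨fun I => (a I).2, ha.1⟩, ha.2⟩
  · exact funext fun I => Fin.val_injective (congrFun h I)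
  · simp only [Finset.coe_filter, Set.mem_ofPred_eq, Finset.mem_filter, Fintype.mem_piFinset,
      Finset.mem_range, Fintype.card_fin, hmem, fullDraconian_univ_iff] at hb
    refine ⟨fun I => ⟨b I, hb.1.1 I⟩, ?_, rfl⟩
    simp only [Finset.coe_filter, Set.mem_ofPred_eq, Finset.mem_univ, true_and]
    exact ⟨hb.1.2, hb.2⟩
  · symm
    exact prod_multiC_add_single_univ y (b := fun I => (a I : ℕ)) (Finset.mem_filter.1 ha).2.1

theorem stmt12 (d : ℕ) (hd : 1 ≤ d) (y : Finset (Fin d) → ℤ)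
    (hy : ∀ E T : Finset (Fin d), E.card = 2 → E ⊆ T →
      0 ≤ ∑ I ∈ univ.filter (fun I : Finset (Fin d) => E ⊆ I ∧ I ⊆ T), y I)
    (P : Set (Fin d → ℝ)) (hP : IsGenPerm P)
    (hPsum : P + (∑ I ∈ univ.filter (fun I : Finset (Fin d) => I.Nonempty ∧ y I < 0),
          ((-(y I) : ℤ) : ℝ) • stdSimp d I)
        = ∑ I ∈ univ.filter (fun I : Finset (Fin d) => I.Nonempty ∧ 0 ≤ y I),
            ((y I : ℤ) : ℝ) • stdSimp d I) :
    ((P ∩ latticePts d).ncard : ℝ)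
      = ∑ a ∈ (Finset.univ : Finset (Finset (Fin d) → Fin d)).filter
          (fun a : Finset (Fin d) → Fin d =>
            (a ∅ : ℕ) = 0 ∧
            (∑ I ∈ univ.filter (fun I : Finset (Fin d) => I.Nonempty), (a I : ℕ)) = d - 1 ∧
            ∀ M : Finset (Finset (Fin d)), M.Nonempty → (∀ J ∈ M, J.Nonempty) →
              1 + ∑ J ∈ M, (a J : ℕ) ≤ (M.sup id).card),
          genC (y univ + (a univ : ℕ)) (a univ : ℕ) *
            ∏ I ∈ univ.filter (fun I : Finset (Fin d) => I.Nonempty ∧ I ≠ univ),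
              genC (y I + (a I : ℕ) - 1) (a I : ℕ) := by
  have : Nonempty (Fin d) := ⟨⟨0, hd⟩⟩
  have hsup : SupermodularOn Finset.univ (zetaSum (y + Pi.single Finset.univ 1)) :=
    (supermodularOn_zetaSum_of_local hy _).zetaSum_add_single Finset.univ
  have hcount := (countsOn Finset.univ_nonempty _ hsup).2
  rw [add_sub_cancel_right] at hcount
  rw [ncard_inter_latticePts hP.1 hPsum, hcount, fullDraconianSum_univ_add_single hd]
end

section
/- Let M be a matroid on a finite ground set E with rank function r. Then Σ_{A ⊊ E} h_{|E∖A|−1} · β̃(M/A) ≥ 0, where the sum is over all proper subsets A of E, M/A denotes the contraction of M by A, β̃ is the signed beta invariant, and h_m = 1 + 1/2 + ⋯ + 1/m (h_0 = 0). -/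
open Finset

/-- The `m`-th harmonic number `h_m = 1 + 1/2 + ⋯ + 1/m` (with `h_0 = 0`). -/
noncomputable def harm (m : ℕ) : ℝ := ∑ i ∈ Finset.Icc 1 m, (1 : ℝ) / i

/-- The beta invariant of the contraction `M/A` of the matroid on ground set `E`
with rank function `r`: here the contraction has ground set `E \ A`, rank function
`X ↦ r(X ∪ A) − r(A)` and rank `r(E) − r(A)`, and
`β(M/A) = (−1)^{r(M/A)} Σ_{X ⊆ E∖A} (−1)^{|X|} r_{M/A}(X)`. -/
noncomputable def betaContr {α : Type*} [DecidableEq α] (E : Finset α) (r : Finset α → ℕ)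
    (A : Finset α) : ℝ :=
  (-1 : ℝ) ^ (r E - r A) *
    ∑ X ∈ (E \ A).powerset, (-1 : ℝ) ^ X.card * ((r (X ∪ A) : ℝ) - (r A : ℝ))

/-- The signed beta invariant `β̃(M/A) = (−1)^{r(M/A)+1} β(M/A)`. -/
noncomputable def signedBetaContr {α : Type*} [DecidableEq α] (E : Finset α)
    (r : Finset α → ℕ) (A : Finset α) : ℝ :=
  (-1 : ℝ) ^ ((r E - r A) + 1) * betaContr E r A

/-- The alternating sum of `f |X|` over the subsets `X` of `B`. -/
noncomputable def altSum {α : Type*} (B : Finset α) (f : ℕ → ℝ) : ℝ :=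
  ∑ X ∈ B.powerset, (-1 : ℝ) ^ X.card * f X.card

theorem altSum_empty {α : Type*} (f : ℕ → ℝ) : altSum (∅ : Finset α) f = f 0 := by
  simp [altSum]

theorem altSum_insert {α : Type*} [DecidableEq α] {a : α} {B : Finset α} (ha : a ∉ B)
    (f : ℕ → ℝ) :
    altSum (insert a B) f = altSum B f - altSum B (fun i => f (i + 1)) := by
  unfold altSum
  rw [sum_powerset_insert ha, sub_eq_add_neg, ← sum_neg_distrib]
  congr 1
  refine sum_congr rfl fun X hX => ?_
  rw [card_insert_of_notMem fun h => ha (mem_powerset.1 hX h), pow_succ]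
  ring

theorem harm_succ (m : ℕ) : harm (m + 1) = harm m + 1 / ((m : ℝ) + 1) := by
  unfold harm
  rw [sum_Icc_succ_top (by omega)]
  push_cast
  rfl

theorem altSum_harm_add {α : Type*} [DecidableEq α] (B : Finset α) (hB : B.Nonempty) (k : ℕ) :
    altSum B (fun i => harm (k + i)) =
      -(((B.card - 1).factorial * k.factorial : ℕ) : ℝ) / ((k + B.card).factorial : ℕ) := by
  induction hB using Finset.Nonempty.cons_induction generalizing k with
  | singleton a =>
    rw [← insert_empty_eq, altSum_insert (by simp), altSum_empty, altSum_empty]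
    have : (k.factorial : ℝ) ≠ 0 := by positivity
    simp only [zero_add, add_zero, harm_succ, insert_empty_eq, card_singleton, Nat.sub_self,
      Nat.factorial_zero, one_mul, Nat.factorial_succ]
    push_cast
    field_simp
    ring
  | cons a B ha hB ih =>
    rw [cons_eq_insert, altSum_insert ha, card_insert_of_notMem ha, ih]
    have h := ih (k + 1)
    simp only [add_right_comm k 1] at h
    simp only [← add_assoc]
    rw [h]
    obtain ⟨b, hb⟩ : ∃ b, B.card = b + 1 := ⟨B.card - 1, by have := hB.card_pos; omega⟩
    rw [hb]
    have h0 : ((k + b).factorial : ℝ) ≠ 0 := by positivity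
    have h1 : ((k : ℝ) + b + 1) ≠ 0 := by positivity
    have h2 : ((k : ℝ) + b + 1 + 1) ≠ 0 := by positivity
    simp only [← add_assoc, Nat.add_sub_cancel, Nat.factorial_succ]
    push_cast
    field_simp
    ring

theorem altSum_harm_sub_one {α : Type*} [DecidableEq α] (B : Finset α) :
    altSum B (fun i => harm (i - 1)) = harm (B.card - 1) := by
  induction B using Finset.induction_on with
  | empty => simp [altSum_empty]
  | insert a B ha ih =>
    rw [altSum_insert ha, ih, card_insert_of_notMem ha]
    simp only [Nat.add_sub_cancel]
    rcases B.eq_empty_or_nonempty with rfl | hB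
    · simp [altSum_empty, harm]
    · have h := altSum_harm_add B hB 0
      simp only [zero_add] at h
      rw [h]
      obtain ⟨b, hb⟩ : ∃ b, B.card = b + 1 := ⟨B.card - 1, by have := hB.card_pos; omega⟩
      have h0 : (b.factorial : ℝ) ≠ 0 := by positivity
      rw [hb, Nat.add_sub_cancel, harm_succ, Nat.factorial_succ]
      push_cast
      simp only [Nat.factorial_zero, Nat.cast_one]
      field_simp
      ring

/-- The coefficient of `r B` in the harmonic sum of the signed beta invariants of the
contractions of `E`, up to sign. -/
noncomputable def harmCoeff {α : Type*} (E B : Finset α) : ℝ :=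
  altSum B (fun i => harm (E.card - B.card + i - 1))

theorem harmCoeff_empty {α : Type*} (E : Finset α) : harmCoeff E ∅ = harm (E.card - 1) := by
  simp [harmCoeff, altSum_empty]

theorem harmCoeff_self {α : Type*} [DecidableEq α] (E : Finset α) :
    harmCoeff E E = harm (E.card - 1) := by
  simp [harmCoeff, altSum_harm_sub_one]

theorem harmCoeff_of_ssubset {α : Type*} [DecidableEq α] {E B : Finset α} (hB : B.Nonempty)
    (h : B ⊂ E) :
    harmCoeff E B = -(((B.card - 1).factorial * (E.card - B.card - 1).factorial : ℕ) : ℝ) /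
      ((E.card - 1).factorial : ℕ) := by
  have hlt := card_lt_card h
  have : harmCoeff E B = altSum B (fun i => harm (E.card - B.card - 1 + i)) := by
    unfold harmCoeff
    congr 1
    funext i
    congr 1
    omega
  rw [this, altSum_harm_add B hB, show E.card - B.card - 1 + B.card = E.card - 1 by omega]

theorem harmCoeff_sdiff {α : Type*} [DecidableEq α] {E B : Finset α} (h : B ⊆ E) :
    harmCoeff E (E \ B) = harmCoeff E B := by
  rcases B.eq_empty_or_nonempty with rfl | hB
  · rw [sdiff_empty, harmCoeff_self, harmCoeff_empty]
  rcases h.eq_or_ssubset with rfl | hs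
  · rw [sdiff_self, bot_eq_empty, harmCoeff_self, harmCoeff_empty]
  have hlt := card_lt_card hs
  rw [harmCoeff_of_ssubset hB hs, harmCoeff_of_ssubset (sdiff_nonempty.2 hs.2)
    (sdiff_ssubset h hB), card_sdiff_of_subset h,
    show E.card - (E.card - B.card) - 1 = B.card - 1 by omega, mul_comm]

theorem sum_harm_mul_sum_powerset {α : Type*} [DecidableEq α] (E : Finset α)
    (f : Finset α → ℝ) :
    ∑ A ∈ E.powerset, harm ((E \ A).card - 1) *
        ∑ X ∈ (E \ A).powerset, (-1 : ℝ) ^ X.card * f (X ∪ A) =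
      ∑ B ∈ E.powerset, harmCoeff E B * f B := by
  simp only [harmCoeff, altSum, mul_sum, sum_mul]
  rw [sum_sigma', sum_sigma']
  refine sum_bij' (fun p _ => ⟨p.2 ∪ p.1, p.2⟩) (fun q _ => ⟨q.1 \ q.2, q.2⟩) ?_ ?_ ?_ ?_ ?_
  · rintro ⟨A, X⟩ h
    simp only [mem_sigma, mem_powerset] at h ⊢
    exact ⟨union_subset (h.2.trans sdiff_subset) h.1, subset_union_left⟩
  · rintro ⟨B, X⟩ h
    simp only [mem_sigma, mem_powerset] at h ⊢
    exact ⟨sdiff_subset.trans h.1, fun x hx => by simp [h.1 (h.2 hx), hx]⟩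
  · rintro ⟨A, X⟩ h
    simp only [mem_sigma, mem_powerset, subset_sdiff] at h
    simp only [union_sdiff_left, sdiff_eq_self_of_disjoint h.2.2.symm]
  · rintro ⟨B, X⟩ h
    simp only [mem_sigma, mem_powerset] at h
    simp only [union_sdiff_of_subset h.2]
  · rintro ⟨A, X⟩ h
    simp only [mem_sigma, mem_powerset, subset_sdiff] at h
    have hc : (X ∪ A).card = X.card + A.card := card_union_of_disjoint h.2.2
    have hle : (X ∪ A).card ≤ E.card := card_le_card (union_subset h.2.1 h.1)
    dsimp only
    rw [card_sdiff_of_subset h.1,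
      show E.card - (X ∪ A).card + X.card - 1 = E.card - A.card - 1 by omega]
    ring

theorem sum_powerset_neg_one_pow_card_real {α : Type*} [DecidableEq α] {B : Finset α}
    (hB : B.Nonempty) : ∑ X ∈ B.powerset, (-1 : ℝ) ^ X.card = 0 := by
  have := sum_powerset_neg_one_pow_card_of_nonempty hB
  exact_mod_cast congrArg (Int.cast : ℤ → ℝ) this

theorem sum_harmCoeff {α : Type*} [DecidableEq α] (E : Finset α) :
    ∑ B ∈ E.powerset, harmCoeff E B = 0 := by
  have h := sum_harm_mul_sum_powerset E (fun _ => 1)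
  simp only [mul_one] at h
  rw [← h]
  refine sum_eq_zero fun A _ => ?_
  rcases (E \ A).eq_empty_or_nonempty with h0 | h0
  · simp [h0, harm]
  · rw [sum_powerset_neg_one_pow_card_real h0, mul_zero]

theorem signedBetaContr_eq {α : Type*} [DecidableEq α] {E A : Finset α} (r : Finset α → ℕ)
    (h : (E \ A).Nonempty) :
    signedBetaContr E r A = -∑ X ∈ (E \ A).powerset, (-1 : ℝ) ^ X.card * (r (X ∪ A) : ℝ) := by
  have hs : (-1 : ℝ) ^ (r E - r A) * (-1 : ℝ) ^ (r E - r A) = 1 := by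
    rw [← mul_pow]; norm_num
  unfold signedBetaContr betaContr
  simp only [mul_sub, sum_sub_distrib]
  rw [← sum_mul, sum_powerset_neg_one_pow_card_real h, pow_succ]
  linear_combination
    -(∑ X ∈ (E \ A).powerset, (-1 : ℝ) ^ X.card * (r (X ∪ A) : ℝ)) * hs

theorem sum_harm_mul_signedBetaContr {α : Type*} [DecidableEq α] (E : Finset α)
    (r : Finset α → ℕ) :
    ∑ A ∈ E.powerset.filter (fun A => A ≠ E),
        harm ((E \ A).card - 1) * signedBetaContr E r A =
      -∑ B ∈ E.powerset, harmCoeff E B * r B := by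
  rw [← sum_harm_mul_sum_powerset E (fun B => (r B : ℝ)), sum_filter, ← sum_neg_distrib]
  refine sum_congr rfl fun A hA => ?_
  split_ifs with h
  · rw [signedBetaContr_eq r (sdiff_nonempty.2 fun h' => h ((mem_powerset.1 hA).antisymm h'))]
    ring
  · simp [not_not.1 h, harm]

/-- A matroid is given by a rank function `r` on subsets of the finite ground set `E`
satisfying the rank axioms: `r X ≤ |X|`, monotonicity and submodularity. -/
theorem stmt13 {α : Type*} [DecidableEq α] (E : Finset α) (r : Finset α → ℕ)
    (hr1 : ∀ X ⊆ E, r X ≤ X.card)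
    (hr2 : ∀ X Y : Finset α, X ⊆ Y → Y ⊆ E → r X ≤ r Y)
    (hr3 : ∀ X Y : Finset α, X ⊆ E → Y ⊆ E → r (X ∪ Y) + r (X ∩ Y) ≤ r X + r Y) :
    0 ≤ ∑ A ∈ E.powerset.filter (fun A => A ≠ E),
        harm ((E \ A).card - 1) * signedBetaContr E r A := by
  have hempty : r ∅ = 0 := by simpa using hr1 ∅ (empty_subset E)
  have hrefl : ∑ B ∈ E.powerset, harmCoeff E B * (r (E \ B) : ℝ) =
      ∑ B ∈ E.powerset, harmCoeff E B * r B := by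
    refine sum_bij' (fun B _ => E \ B) (fun B _ => E \ B) (by simp) (by simp) ?_ ?_ ?_
    · exact fun B hB => Finset.sdiff_sdiff_eq_self (mem_powerset.1 hB)
    · exact fun B hB => Finset.sdiff_sdiff_eq_self (mem_powerset.1 hB)
    · intro B hB
      rw [harmCoeff_sdiff (mem_powerset.1 hB)]
  have hnonpos : ∑ B ∈ E.powerset,
      harmCoeff E B * ((r B : ℝ) + r (E \ B) - r E) ≤ 0 := by
    refine sum_nonpos fun B hB => ?_
    have hBE := mem_powerset.1 hB
    rcases B.eq_empty_or_nonempty with rfl | hne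
    · simp [hempty]
    rcases hBE.eq_or_ssubset with rfl | hs
    · simp [hempty]
    refine mul_nonpos_of_nonpos_of_nonneg ?_ ?_
    · rw [harmCoeff_of_ssubset hne hs, neg_div]
      exact neg_nonpos.2 (by positivity)
    · have h := hr3 B (E \ B) hBE sdiff_subset
      rw [union_sdiff_of_subset hBE] at h
      have h' : (r E : ℝ) ≤ r B + r (E \ B) := by exact_mod_cast (by omega)
      linarith
  simp only [mul_sub, mul_add, sum_sub_distrib, sum_add_distrib] at hnonpos
  rw [← sum_mul, sum_harmCoeff, hrefl] at hnonpos
  rw [sum_harm_mul_signedBetaContr]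
  linarith
end

section
/- Let M be a matroid on a finite ground set E with rank function r. Then Σ_{A ⊆ E} h_{|E∖A|} · β̃(M/A) ≥ 0, where the sum is over all subsets A of E, M/A denotes the contraction of M by A, β̃ is the signed beta invariant, and h_m = 1 + 1/2 + ⋯ + 1/m (h_0 = 0). -/
open Finset

/-- The alternating sum of shifted harmonic numbers over the subsets of a nonempty finite set,
that is, an iterated finite difference of the harmonic numbers. -/
theorem sum_powerset_neg_one_pow_mul_harm {α : Type*} [DecidableEq α] (s : Finset α)
    (hs : s.Nonempty) (m : ℕ) :
    ∑ X ∈ s.powerset, (-1 : ℝ) ^ X.card * harm (m + X.card) =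
      -((m.factorial : ℝ) * ((s.card - 1).factorial : ℝ) / ((m + s.card).factorial : ℝ)) := by
  induction hs using Finset.Nonempty.cons_induction generalizing m with
  | singleton a =>
    rw [← insert_empty_eq, Finset.sum_powerset_insert (by simp)]
    have := Nat.factorial_pos m
    simp [harm_succ, Nat.factorial_succ]
    field_simp
  | cons a s ha hs ih =>
    have hshift : ∀ X ∈ s.powerset,
        (-1 : ℝ) ^ (insert a X).card * harm (m + (insert a X).card) =
          -((-1 : ℝ) ^ X.card * harm (m + 1 + X.card)) := by
      intro X hX
      rw [Finset.card_insert_of_notMem fun h => ha (Finset.mem_powerset.1 hX h), pow_succ,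
        show m + (X.card + 1) = m + 1 + X.card by omega]
      ring
    obtain ⟨k, hk⟩ : ∃ k, s.card = k + 1 := ⟨s.card - 1, by have := hs.card_pos; omega⟩
    rw [Finset.cons_eq_insert, Finset.sum_powerset_insert ha, Finset.sum_congr rfl hshift,
      Finset.sum_neg_distrib, ih, ih, Finset.card_insert_of_notMem ha, hk,
      show m + 1 + (k + 1) = m + k + 1 + 1 by omega,
      show m + (k + 1 + 1) = m + k + 1 + 1 by omega, ← add_assoc m k 1]
    simp only [Nat.add_sub_cancel, Nat.factorial_succ]
    have := Nat.factorial_pos (m + k)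
    push_cast
    field_simp
    ring

theorem harm_mul_signedBetaContr {α : Type*} [DecidableEq α] (E : Finset α)
    (r : Finset α → ℕ) (A : Finset α) :
    harm ((E \ A).card) * signedBetaContr E r A =
      -∑ X ∈ (E \ A).powerset, (-1 : ℝ) ^ X.card * harm ((E \ A).card) * (r (X ∪ A) : ℝ) := by
  have hsign : signedBetaContr E r A =
      -∑ X ∈ (E \ A).powerset, (-1 : ℝ) ^ X.card * ((r (X ∪ A) : ℝ) - (r A : ℝ)) := by
    rw [signedBetaContr, betaContr, ← mul_assoc, ← pow_add,
      Odd.neg_one_pow ⟨r E - r A, by ring⟩, neg_one_mul]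
  have hzero : harm ((E \ A).card) * ∑ X ∈ (E \ A).powerset, (-1 : ℝ) ^ X.card = 0 := by
    rcases (E \ A).eq_empty_or_nonempty with h | h
    · simp [h, harm]
    · have := congrArg (Int.cast : ℤ → ℝ) (Finset.sum_powerset_neg_one_pow_card_of_nonempty h)
      push_cast at this
      rw [this, mul_zero]
  simp only [hsign, mul_sub, Finset.sum_sub_distrib, ← Finset.sum_mul]
  linear_combination (r A : ℝ) * hzero -
    (Finset.mul_sum (E \ A).powerset (fun X => (-1 : ℝ) ^ X.card * (r (X ∪ A) : ℝ))
      (harm (E \ A).card)) - Finset.sum_congr (rfl : (E \ A).powerset = _) (fun X _ => show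
      harm (E \ A).card * ((-1 : ℝ) ^ X.card * (r (X ∪ A) : ℝ)) =
        (-1 : ℝ) ^ X.card * harm (E \ A).card * (r (X ∪ A) : ℝ) by ring)

/-- Summing over disjoint pairs `(A, X)` of subsets of `E` amounts to summing over pairs
`X ⊆ Y ⊆ E` with `Y = X ∪ A`. -/
theorem sum_powerset_sdiff_comm {α : Type*} [DecidableEq α] (E : Finset α)
    (f : ℕ → ℕ → Finset α → ℝ) :
    ∑ A ∈ E.powerset, ∑ X ∈ (E \ A).powerset, f X.card (E \ A).card (X ∪ A) =
      ∑ Y ∈ E.powerset, ∑ X ∈ Y.powerset, f X.card ((E \ Y).card + X.card) Y := by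
  rw [Finset.sum_sigma', Finset.sum_sigma']
  refine Finset.sum_bij' (fun p _ => ⟨p.2 ∪ p.1, p.2⟩) (fun p _ => ⟨p.1 \ p.2, p.2⟩)
    ?_ ?_ ?_ ?_ ?_
  · rintro ⟨A, X⟩ h
    simp only [Finset.mem_sigma, Finset.mem_powerset] at h ⊢
    exact ⟨Finset.union_subset (h.2.trans Finset.sdiff_subset) h.1, Finset.subset_union_left⟩
  · rintro ⟨Y, X⟩ h
    simp only [Finset.mem_sigma, Finset.mem_powerset] at h ⊢
    exact ⟨Finset.sdiff_subset.trans h.1, fun x hx => by grind⟩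
  · rintro ⟨A, X⟩ h
    simp only [Finset.mem_sigma, Finset.mem_powerset] at h
    have : (X ∪ A) \ X = A := by grind
    simp [this]
  · rintro ⟨Y, X⟩ h
    simp only [Finset.mem_sigma, Finset.mem_powerset] at h
    simp [Finset.union_eq_right.2 h.2]
  · rintro ⟨A, X⟩ h
    simp only [Finset.mem_sigma, Finset.mem_powerset] at h
    have hsplit : E \ A = (E \ (X ∪ A)) ∪ X := by grind
    have hdisj : Disjoint (E \ (X ∪ A)) X := by
      rw [Finset.disjoint_left]; grind
    simp only [← Finset.card_union_of_disjoint hdisj, ← hsplit]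

/-- A matroid is given by a rank function `r` on subsets of the finite ground set `E`
satisfying the rank axioms: `r X ≤ |X|`, monotonicity and submodularity. -/
theorem stmt14 {α : Type*} [DecidableEq α] (E : Finset α) (r : Finset α → ℕ)
    (hr1 : ∀ X ⊆ E, r X ≤ X.card)
    (hr2 : ∀ X Y : Finset α, X ⊆ Y → Y ⊆ E → r X ≤ r Y)
    (hr3 : ∀ X Y : Finset α, X ⊆ E → Y ⊆ E → r (X ∪ Y) + r (X ∩ Y) ≤ r X + r Y) :
    0 ≤ ∑ A ∈ E.powerset,
        harm ((E \ A).card) * signedBetaContr E r A := by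
  simp only [harm_mul_signedBetaContr, Finset.sum_neg_distrib]
  rw [sum_powerset_sdiff_comm E fun i j Y => (-1 : ℝ) ^ i * harm j * (r Y : ℝ),
    ← Finset.sum_neg_distrib]
  refine Finset.sum_nonneg fun Y hY => ?_
  rw [← Finset.sum_mul]
  rcases Y.eq_empty_or_nonempty with rfl | hne
  · have : r ∅ = 0 := by simpa using hr1 ∅ (Finset.empty_subset E)
    simp [this]
  · rw [sum_powerset_neg_one_pow_mul_harm Y hne, neg_mul, neg_neg]
    positivity
end
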